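/- Let $R$ be a Gorenstein commutative noetherian local ring of positive dimension. Then $R$ satisfies the depth formula property (dep) if and only if $R$ is an AB ring. -/

import Mathlib

open CategoryTheory IsLocalRing

noncomputable section

/-- The `i`-th Ext group of `R`-modules `M`, `N`, as a `ModuleCat R`. -/
def ExtGroup (R : Type) [CommRing R] (i : ℕ) (M N : ModuleCat.{0} R) : ModuleCat R :=
  ((Ext R (ModuleCat.{0} R) i).obj (Opposite.op M)).obj N

/-- The `i`-th Tor group. -/
def TorGroup (R : Type) [CommRing R] (i : ℕ) (M N : ModuleCat.{0} R) : ModuleCat R :=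
  ((Tor (ModuleCat.{0} R) i).obj M).obj N

/-- `Ext_R^i(M, N) = 0` for all `i ≫ 0`. -/
def ExtEventuallyZero (R : Type) [CommRing R] (M N : ModuleCat.{0} R) : Prop :=
  ∃ t : ℕ, ∀ i > t, Subsingleton (ExtGroup R i M N)

/-- Property (ee). -/
def PropEE (R : Type) [CommRing R] : Prop :=
  ∀ M N : ModuleCat.{0} R, Module.Finite R M → Module.Finite R N →
    ExtEventuallyZero R M N → ExtEventuallyZero R N M

/-- Gorenstein: `Ext^i(k, R) = 0` for `i ≫ 0`. -/
def IsGorensteinLocalRing (R : Type) [CommRing R] [IsLocalRing R] : Prop :=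
  ∃ t : ℕ, ∀ i > t, Subsingleton
    (ExtGroup R i (ModuleCat.of R (ResidueField R)) (ModuleCat.of R R))

open Classical in
/-- depth of a module over a local ring, with depth of zero module = ⊤. -/
def rdepth (R : Type) [CommRing R] [IsLocalRing R]
    (M : Type) [AddCommGroup M] [Module R M] : ℕ∞ :=
  if Subsingleton M then ⊤ else
    sSup {n : ℕ∞ | ∃ rs : List R, (rs.length : ℕ∞) = n ∧
      (∀ r ∈ rs, r ∈ maximalIdeal R) ∧ RingTheory.Sequence.IsRegular M rs}

/-- Totally reflexive module. -/
def IsTotallyReflexive (R : Type) [CommRing R]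
    (M : Type) [AddCommGroup M] [Module R M] : Prop :=
  Module.Finite R M ∧ Function.Bijective (Module.Dual.eval R M) ∧
  (∀ i > 0, Subsingleton (ExtGroup R i (ModuleCat.of R M) (ModuleCat.of R R))) ∧
  (∀ i > 0, Subsingleton
    (ExtGroup R i (ModuleCat.of R (Module.Dual R M)) (ModuleCat.of R R)))

/-- Property (tr). -/
def PropTR (R : Type) [CommRing R] : Prop :=
  ∀ (M : Type) [AddCommGroup M] [Module R M], Module.Finite R M →
    (∀ i > 0, Subsingleton (ExtGroup R i (ModuleCat.of R M) (ModuleCat.of R R))) →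
    IsTotallyReflexive R M

/-- Property (dep): the depth formula (written additively to avoid truncated subtraction). -/
def PropDep (R : Type) [CommRing R] [IsLocalRing R] : Prop :=
  ∀ (M N : Type) [AddCommGroup M] [Module R M] [AddCommGroup N] [Module R N],
    Module.Finite R M → Module.Finite R N → Nontrivial M → Nontrivial N →
    (∀ i > 0, Subsingleton (TorGroup R i (ModuleCat.of R M) (ModuleCat.of R N))) →
    rdepth R (TensorProduct R M N) + rdepth R R = rdepth R M + rdepth R N

/-- AB ring. -/
def IsABRing (R : Type) [CommRing R] [IsLocalRing R] : Prop :=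
  IsGorensteinLocalRing R ∧ ∃ n : ℕ, ∀ M N : ModuleCat.{0} R,
    Module.Finite R M → Module.Finite R N → ExtEventuallyZero R M N →
    ∀ i > n, Subsingleton (ExtGroup R i M N)

/-- A complex of finitely generated projective modules, indexed by `ℤ`. -/
structure FGProjComplex (R : Type) [CommRing R] where
  X : ℤ → Type
  [acg : ∀ n, AddCommGroup (X n)]
  [mod : ∀ n, Module R (X n)]
  [fin : ∀ n, Module.Finite R (X n)]
  [proj : ∀ n, Module.Projective R (X n)]
  d : ∀ n : ℤ, X n →ₗ[R] X (n + 1)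
  dd : ∀ n : ℤ, (d (n + 1)).comp (d n) = 0

attribute [instance] FGProjComplex.acg FGProjComplex.mod FGProjComplex.fin FGProjComplex.proj

/-- Acyclicity of such a complex. -/
def FGProjComplex.Acyclic {R : Type} [CommRing R] (C : FGProjComplex R) : Prop :=
  ∀ n : ℤ, LinearMap.ker (C.d (n + 1)) = LinearMap.range (C.d n)

/-- The dual complex is acyclic. -/
def FGProjComplex.DualAcyclic {R : Type} [CommRing R] (C : FGProjComplex R) : Prop :=
  ∀ n : ℤ, LinearMap.ker ((C.d n).dualMap) = LinearMap.range ((C.d (n + 1)).dualMap)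

/-- Property (tac): every acyclic complex of f.g. projective modules is totally acyclic. -/
def PropTAC (R : Type) [CommRing R] : Prop :=
  ∀ C : FGProjComplex R, C.Acyclic → C.DualAcyclic

/-- `M` is an ∞-syzygy. -/
def IsInfiniteSyzygy (R : Type) [CommRing R]
    (M : Type) [AddCommGroup M] [Module R M] : Prop :=
  Module.Finite R M ∧
  ∃ (k : ℕ → ℕ) (f : M →ₗ[R] (Fin (k 0) → R))
    (d : ∀ n : ℕ, (Fin (k n) → R) →ₗ[R] (Fin (k (n + 1)) → R)),
    Function.Injective f ∧ LinearMap.ker (d 0) = LinearMap.range f ∧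
    ∀ n : ℕ, LinearMap.ker (d (n + 1)) = LinearMap.range (d n)

end

noncomputable section

/-- Minimal `n`-th syzygy: `IsMinimalSyzygy R n M K` says `K` is the `n`-th syzygy of `M`
computed from a minimal free resolution. -/
def IsMinimalSyzygy (R : Type) [CommRing R] [IsLocalRing R] :
    ℕ → ModuleCat.{0} R → ModuleCat.{0} R → Prop
  | 0, M, K => Nonempty (K ≃ₗ[R] M)
  | n + 1, M, K => ∃ (m : ℕ) (f : (Fin m → R) →ₗ[R] M),
      Function.Surjective f ∧
      (LinearMap.ker f ≤ (maximalIdeal R) • (⊤ : Submodule R (Fin m → R))) ∧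
      IsMinimalSyzygy R n (ModuleCat.of R (LinearMap.ker f)) K

/-- A resolving class of modules: contains `R`, closed under isomorphisms, direct summands,
extensions and syzygies. -/
def IsResolvingClass (R : Type) [CommRing R] (P : ModuleCat.{0} R → Prop) : Prop :=
  (P (ModuleCat.of R R)) ∧
  (∀ X Y : ModuleCat.{0} R, Nonempty (X ≃ₗ[R] Y) → P X → P Y) ∧
  (∀ (X Y : ModuleCat.{0} R) (i : X →ₗ[R] Y) (r : Y →ₗ[R] X),
      r.comp i = LinearMap.id → P Y → P X) ∧
  (∀ (X Y Z : ModuleCat.{0} R) (f : X →ₗ[R] Y) (g : Y →ₗ[R] Z),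
      Function.Injective f → Function.Surjective g → LinearMap.ker g = LinearMap.range f →
      P X → P Z → P Y) ∧
  (∀ (X Y : ModuleCat.{0} R) (m : ℕ) (f : (Fin m → R) →ₗ[R] X), Function.Surjective f →
      Nonempty (Y ≃ₗ[R] LinearMap.ker f) → P X → P Y)

/-- `N` belongs to the resolving closure `res M`. -/
def InResolvingClosure (R : Type) [CommRing R] (M N : ModuleCat.{0} R) : Prop :=
  ∀ P : ModuleCat.{0} R → Prop, IsResolvingClass R P → P M → P N

/-- `M` has finite G-dimension: it admits a finite resolution by totally reflexive modules. -/
def HasFiniteGDim (R : Type) [CommRing R] (M : Type) [AddCommGroup M] [Module R M] : Prop :=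
  ∃ (n : ℕ) (T : ℕ → ModuleCat.{0} R) (d : ∀ i : ℕ, T (i + 1) →ₗ[R] T i) (ε : T 0 →ₗ[R] M),
    (∀ i, IsTotallyReflexive R (T i)) ∧ Function.Surjective ε ∧
    LinearMap.ker ε = LinearMap.range (d 0) ∧
    (∀ i, LinearMap.ker (d i) = LinearMap.range (d (i + 1))) ∧
    (∀ i > n, Subsingleton (T i))

/-- `ω` is a canonical module of the `d`-dimensional Cohen–Macaulay local ring `R`:
`Ext^i(k, ω)` vanishes for `i ≠ d` and is isomorphic to `k` for `i = d`. -/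
def IsCanonicalModule (R : Type) [CommRing R] [IsLocalRing R] (d : ℕ)
    (ω : ModuleCat.{0} R) : Prop :=
  Module.Finite R ω ∧
  (∀ i : ℕ, i ≠ d → Subsingleton (ExtGroup R i (ModuleCat.of R (ResidueField R)) ω)) ∧
  Nonempty ((ExtGroup R d (ModuleCat.of R (ResidueField R)) ω) ≃ₗ[R] (ResidueField R))

/-- Cohen–Macaulay local ring: depth equals Krull dimension. -/
def IsCohenMacaulayLocalRing (R : Type) [CommRing R] [IsLocalRing R] : Prop :=
  (rdepth R R : WithBot ℕ∞) = ringKrullDim R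

end

section ExtInterface

open Abelian
open scoped Pointwise

/-- Vanishing of the `i`-th Ext group of unbundled modules. -/
def ExtVanish (R : Type) [CommRing R] (i : ℕ) (M N : Type) [AddCommGroup M] [Module R M]
    [AddCommGroup N] [Module R N] : Prop :=
  Subsingleton (Abelian.Ext.{0} (ModuleCat.of R M) (ModuleCat.of R N) i)

/-- The element `x` annihilates the `i`-th Ext group. -/
def ExtKilled {R : Type} [CommRing R] (x : R) (i : ℕ) (M N : Type) [AddCommGroup M] [Module R M]
    [AddCommGroup N] [Module R N] : Prop :=
  ∀ e : Abelian.Ext.{0} (ModuleCat.of R M) (ModuleCat.of R N) i, x • e = 0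

/-- Short exact sequences of modules. -/
structure IsSES {R : Type} [CommRing R] {A B C : Type} [AddCommGroup A] [Module R A]
    [AddCommGroup B] [Module R B] [AddCommGroup C] [Module R C]
    (f : A →ₗ[R] B) (g : B →ₗ[R] C) : Prop where
  inj : Function.Injective f
  exact : Function.Exact f g
  surj : Function.Surjective g

variable {R : Type} [CommRing R] {A B C X Y : Type} [AddCommGroup A] [Module R A]
  [AddCommGroup B] [Module R B] [AddCommGroup C] [Module R C]
  [AddCommGroup X] [Module R X] [AddCommGroup Y] [Module R Y]
  {f : A →ₗ[R] B} {g : B →ₗ[R] C}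

/-- The short complex in `ModuleCat` attached to a short exact sequence. -/
abbrev IsSES.cx (h : IsSES f g) : ShortComplex (ModuleCat.{0} R) :=
  ModuleCat.shortComplexOfCompEqZero f g h.exact.linearMap_comp_eq_zero

lemma IsSES.shortExact (h : IsSES f g) : h.cx.ShortExact :=
  ModuleCat.shortComplex_shortExact _ h.exact h.inj h.surj

lemma ExtVanish.eq_zero {i : ℕ} (h : ExtVanish R i X Y)
    (e : Abelian.Ext.{0} (ModuleCat.of R X) (ModuleCat.of R Y) i) : e = 0 :=
  @Subsingleton.elim _ h _ _

lemma extVanish_of_eq_zero {i : ℕ}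
    (h : ∀ e : Abelian.Ext.{0} (ModuleCat.of R X) (ModuleCat.of R Y) i, e = 0) :
    ExtVanish R i X Y := ⟨fun a b => by rw [h a, h b]⟩

lemma IsSES.extVanish_middle (h : IsSES f g) {i : ℕ} (h1 : ExtVanish R i C Y)
    (h2 : ExtVanish R i A Y) : ExtVanish R i B Y := by
  refine extVanish_of_eq_zero fun e => ?_
  obtain ⟨x, hx⟩ := Ext.contravariant_sequence_exact₂ h.shortExact (ModuleCat.of R Y) (n := i) e
    (h2.eq_zero _)
  rw [← hx, h1.eq_zero x, Ext.comp_zero]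

lemma IsSES.extVanish_right (h : IsSES f g) {i : ℕ} (h1 : ExtVanish R i A Y)
    (h2 : ExtVanish R (i + 1) B Y) : ExtVanish R (i + 1) C Y := by
  refine extVanish_of_eq_zero fun e => ?_
  obtain ⟨x, hx⟩ := Ext.contravariant_sequence_exact₃ h.shortExact (ModuleCat.of R Y) e
    (h2.eq_zero _) (add_comm 1 i)
  rw [← hx, h1.eq_zero x, Ext.comp_zero]

lemma IsSES.extVanish_left (h : IsSES f g) {i : ℕ} (h1 : ExtVanish R i B Y)
    (h2 : ExtVanish R (i + 1) C Y) : ExtVanish R i A Y := by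
  refine extVanish_of_eq_zero fun e => ?_
  obtain ⟨x, hx⟩ := Ext.contravariant_sequence_exact₁ h.shortExact (ModuleCat.of R Y) e
    (add_comm 1 i) (h2.eq_zero _)
  rw [← hx, h1.eq_zero x, Ext.comp_zero]

lemma IsSES.extVanish_middle' (h : IsSES f g) {i : ℕ} (h1 : ExtVanish R i X A)
    (h2 : ExtVanish R i X C) : ExtVanish R i X B := by
  refine extVanish_of_eq_zero fun e => ?_
  obtain ⟨x, hx⟩ := Ext.covariant_sequence_exact₂ (ModuleCat.of R X) h.shortExact (n := i) e
    (h2.eq_zero _)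
  rw [← hx, h1.eq_zero x, Ext.zero_comp]

lemma IsSES.extVanish_left' (h : IsSES f g) {i : ℕ} (h1 : ExtVanish R i X C)
    (h2 : ExtVanish R (i + 1) X B) : ExtVanish R (i + 1) X A := by
  refine extVanish_of_eq_zero fun e => ?_
  obtain ⟨x, hx⟩ := Ext.covariant_sequence_exact₁ (ModuleCat.of R X) h.shortExact e
    (h2.eq_zero _) rfl
  rw [← hx, h1.eq_zero x, Ext.zero_comp]

lemma IsSES.extVanish_right' (h : IsSES f g) {i : ℕ} (h1 : ExtVanish R i X B)
    (h2 : ExtVanish R (i + 1) X A) : ExtVanish R i X C := by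
  refine extVanish_of_eq_zero fun e => ?_
  obtain ⟨x, hx⟩ := Ext.covariant_sequence_exact₃ (ModuleCat.of R X) h.shortExact e rfl
    (h2.eq_zero _)
  rw [← hx, h1.eq_zero x, Ext.zero_comp]

lemma extVanish_of_projective (P : Type) [AddCommGroup P] [Module R P] [Module.Projective R P]
    (i : ℕ) : ExtVanish R (i + 1) P Y := by
  have : Projective (ModuleCat.of R P) :=
    (IsProjective.iff_projective P).mp inferInstance
  exact extVanish_of_eq_zero fun e => e.eq_zero_of_projective

lemma extVanish_zero_iff : ExtVanish R 0 X Y ↔ Subsingleton (X →ₗ[R] Y) :=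
  (Ext.addEquiv₀.toEquiv.trans ModuleCat.homEquiv).subsingleton_congr

lemma extVanish_congr (e : A ≃ₗ[R] B) (i : ℕ) (h : ExtVanish R i A Y) : ExtVanish R i B Y := by
  refine extVanish_of_eq_zero fun z => ?_
  have h1 : ModuleCat.ofHom e.symm.toLinearMap ≫ ModuleCat.ofHom e.toLinearMap = 𝟙 _ := by
    ext; simp
  rw [← Ext.mk₀_id_comp z, ← h1, ← Ext.mk₀_comp_mk₀_assoc, h.eq_zero ((Ext.mk₀ _).comp z _),
    Ext.comp_zero]

lemma extVanish_congr' (e : A ≃ₗ[R] B) (i : ℕ) (h : ExtVanish R i X A) : ExtVanish R i X B := by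
  refine extVanish_of_eq_zero fun z => ?_
  have h1 : ModuleCat.ofHom e.symm.toLinearMap ≫ ModuleCat.ofHom e.toLinearMap = 𝟙 _ := by
    ext; simp
  rw [← Ext.comp_mk₀_id z, ← h1, ← Ext.mk₀_comp_mk₀, ← Ext.comp_assoc_of_third_deg_zero,
    h.eq_zero (z.comp _ _), Ext.zero_comp]

lemma extVanish_of_subsingleton [Subsingleton X] (i : ℕ) : ExtVanish R i X Y := by
  refine extVanish_of_eq_zero fun z => ?_
  have h1 : 𝟙 (ModuleCat.of R X) = 0 := by ext x; exact Subsingleton.elim (α := X) _ _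
  rw [← Ext.mk₀_id_comp z, h1, Ext.mk₀_zero, Ext.zero_comp]

lemma extVanish_of_subsingleton' [Subsingleton Y] (i : ℕ) : ExtVanish R i X Y := by
  refine extVanish_of_eq_zero fun z => ?_
  have h1 : 𝟙 (ModuleCat.of R Y) = 0 := by ext x; exact Subsingleton.elim (α := Y) _ _
  rw [← Ext.comp_mk₀_id z, h1, Ext.mk₀_zero, Ext.comp_zero]

lemma IsSES.exists_extend_of_killed (h : IsSES f g) {x : R} (hx : ExtKilled x 1 C Y)
    (φ : A →ₗ[R] Y) : ∃ ψ : B →ₗ[R] Y, ψ.comp f = x • φ := by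
  obtain ⟨e, he⟩ := Ext.contravariant_sequence_exact₁ h.shortExact (ModuleCat.of R Y)
    (Ext.mk₀ (x • ModuleCat.ofHom φ)) (add_comm 1 0) (by
      rw [Ext.mk₀_smul, Ext.comp_smul]
      exact hx _)
  obtain ⟨e, rfl⟩ := (Ext.mk₀_bijective _ _).2 e
  rw [Ext.mk₀_comp_mk₀] at he
  refine ⟨e.hom, ?_⟩
  have := (Ext.mk₀_bijective _ _).1 he
  exact congrArg ModuleCat.Hom.hom this

lemma ExtVanish.killed {i : ℕ} (h : ExtVanish R i X Y) (x : R) : ExtKilled x i X Y :=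
  fun _ => h.eq_zero _

lemma IsSES.exists_extend (h : IsSES f g) (hx : ExtVanish R 1 C Y)
    (φ : A →ₗ[R] Y) : ∃ ψ : B →ₗ[R] Y, ψ.comp f = φ := by
  simpa using h.exists_extend_of_killed (hx.killed 1) φ

lemma IsSES.extVanish_one (h : IsSES f g) (hB : ExtVanish R 1 B Y)
    (H : ∀ φ : A →ₗ[R] Y, ∃ ψ : B →ₗ[R] Y, ψ.comp f = φ) : ExtVanish R 1 C Y := by
  refine extVanish_of_eq_zero fun e => ?_
  obtain ⟨x, hx⟩ := Ext.contravariant_sequence_exact₃ h.shortExact (ModuleCat.of R Y) e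
    (hB.eq_zero _) (add_comm 1 0)
  obtain ⟨x, rfl⟩ := (Ext.mk₀_bijective _ _).2 x
  obtain ⟨ψ, hψ⟩ := H x.hom
  have : x = ModuleCat.ofHom f ≫ ModuleCat.ofHom ψ := by
    ext a; simp [← hψ]
  rw [← hx, this, ← Ext.mk₀_comp_mk₀, h.shortExact.extClass_comp_assoc]

lemma IsSES.extKilled_left (h : IsSES f g) {x : R} {i : ℕ} (hB : ExtVanish R i B Y)
    (hC : ExtKilled x (i + 1) C Y) : ExtKilled x i A Y := by
  intro e
  obtain ⟨z, hz⟩ := Ext.contravariant_sequence_exact₁ h.shortExact (ModuleCat.of R Y) (x • e)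
    (add_comm 1 i) (by rw [Ext.comp_smul]; exact hC _)
  rw [← hz, hB.eq_zero z, Ext.comp_zero]

lemma extKilled_of_annihilates {x : R} (i : ℕ) (h : ∀ m : X, x • m = 0) : ExtKilled x i X Y := by
  intro e
  have h1 : x • 𝟙 (ModuleCat.of R X) = 0 := by ext m; exact h m
  rw [← Ext.mk₀_id_comp e, ← Ext.smul_comp, ← Ext.mk₀_smul, h1, Ext.mk₀_zero, Ext.zero_comp]

/-- The sequence `0 → M → M → M / x M → 0` for an `M`-regular element `x`. -/
lemma IsSMulRegular.isSES {x : R} (h : IsSMulRegular X x) :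
    IsSES (LinearMap.lsmul R X x) (Submodule.mkQ (x • (⊤ : Submodule R X))) :=
  ⟨h, LinearMap.exact_lsmul_mkQ_smul_top X x, Submodule.mkQ_surjective _⟩

lemma IsSES.extVanish_of_lsmul [IsLocalRing R] [IsNoetherianRing R] [Module.Finite R X]
    [Module.Finite R Y] {x : R} (hx : x ∈ maximalIdeal R) {g : X →ₗ[R] C}
    (h : IsSES (LinearMap.lsmul R X x) g) {i : ℕ} (hC : ExtVanish R (i + 1) C Y) :
    ExtVanish R i X Y := by
  have fin : Module.Finite R (Ext.{0} (ModuleCat.of R X) (ModuleCat.of R Y) i) := inferInstance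
  have key : (⊤ : Submodule R (Ext.{0} (ModuleCat.of R X) (ModuleCat.of R Y) i)) = ⊥ := by
    refine Submodule.eq_bot_of_le_smul_of_le_jacobson_bot (maximalIdeal R) _ fin.1 ?_
      (IsLocalRing.maximalIdeal_le_jacobson _)
    intro e _
    obtain ⟨z, hz⟩ := Ext.contravariant_sequence_exact₁ h.shortExact (ModuleCat.of R Y) e
      (add_comm 1 i) (hC.eq_zero _)
    have h1 : h.cx.f = x • 𝟙 (ModuleCat.of R X) := by ext m; rfl
    rw [← hz, h1, Ext.mk₀_smul, Ext.smul_comp, Ext.mk₀_id_comp]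
    exact Submodule.smul_mem_smul hx trivial
  exact extVanish_of_eq_zero fun e => by
    have : e ∈ (⊤ : Submodule R (Ext.{0} (ModuleCat.of R X) (ModuleCat.of R Y) i)) := trivial
    rw [key] at this
    exact this

lemma isSES_prod : IsSES (LinearMap.inl R A B) (LinearMap.snd R A B) :=
  ⟨LinearMap.inl_injective, Function.Exact.inl_snd, LinearMap.snd_surjective⟩

lemma extVanish_pi {i : ℕ} (h : ExtVanish R i X Y) (n : ℕ) : ExtVanish R i (Fin n → X) Y := by
  induction n with
  | zero => exact extVanish_of_subsingleton i
  | succ n ih =>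
    exact extVanish_congr (Fin.consLinearEquiv R (fun _ => X)) i (isSES_prod.extVanish_middle ih h)

lemma extVanish_pi' {i : ℕ} (h : ExtVanish R i Y X) (n : ℕ) : ExtVanish R i Y (Fin n → X) := by
  induction n with
  | zero => exact extVanish_of_subsingleton' i
  | succ n ih =>
    exact extVanish_congr' (Fin.consLinearEquiv R (fun _ => X)) i (isSES_prod.extVanish_middle' h ih)

/-- Given a morphism of short exact sequences from `A → B → C` to `A' → B' → C'` whose last
component `C → C'` is injective with cokernel `E`, the vanishing of `Ext²(E, Y)` and `Ext¹(B', Y)`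
forces every map `A → Y` to be a sum of a map extending to `A'` and one extending to `B`. -/
lemma extend_of_extVanish_two {A B C A' B' C' E : Type}
    [AddCommGroup A] [Module R A] [AddCommGroup B] [Module R B] [AddCommGroup C] [Module R C]
    [AddCommGroup A'] [Module R A'] [AddCommGroup B'] [Module R B'] [AddCommGroup C'] [Module R C']
    [AddCommGroup E] [Module R E]
    {f : A →ₗ[R] B} {g : B →ₗ[R] C} {f' : A' →ₗ[R] B'} {g' : B' →ₗ[R] C'}
    {v : C' →ₗ[R] E} {a : A →ₗ[R] A'} {b : B →ₗ[R] B'} {c : C →ₗ[R] C'}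
    (h : IsSES f g) (h' : IsSES f' g') (hE : IsSES c v)
    (hab : b.comp f = f'.comp a) (hbc : c.comp g = g'.comp b)
    (hv : ExtVanish R 2 E Y) (hBY : ExtVanish R 1 B' Y)
    (φ : A →ₗ[R] Y) : ∃ (ψ₁ : A' →ₗ[R] Y) (ψ₂ : B →ₗ[R] Y), φ = ψ₁.comp a + ψ₂.comp f := by
  -- the class of `φ` in `Ext¹(C, Y)` lifts to `Ext¹(C', Y)`
  obtain ⟨z, hz⟩ := Ext.contravariant_sequence_exact₁ hE.shortExact (ModuleCat.of R Y)
    (h.shortExact.extClass.comp (Ext.mk₀ (ModuleCat.ofHom φ)) (add_zero 1)) (add_comm 1 1)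
    (hv.eq_zero _)
  obtain ⟨w, hw⟩ := Ext.contravariant_sequence_exact₃ h'.shortExact (ModuleCat.of R Y) z
    (hBY.eq_zero _) (add_comm 1 0)
  obtain ⟨w, rfl⟩ := (Ext.mk₀_bijective _ _).2 w
  let F : h.cx ⟶ h'.cx :=
    { τ₁ := ModuleCat.ofHom a, τ₂ := ModuleCat.ofHom b, τ₃ := ModuleCat.ofHom c
      comm₁₂ := by
        ext m; exact (LinearMap.congr_fun hab m).symm
      comm₂₃ := by
        ext m; exact (LinearMap.congr_fun hbc m).symm }
  have nat := ShortComplex.ShortExact.extClass_naturality h.shortExact h'.shortExact F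
  have e1 : h.shortExact.extClass.comp (Ext.mk₀ (ModuleCat.ofHom φ - ModuleCat.ofHom a ≫ w))
      (add_zero 1) = 0 := by
    rw [sub_eq_add_neg, Ext.mk₀_add, Ext.comp_add, ← hz, ← hw, Ext.mk₀_neg, Ext.comp_neg]
    have : (Ext.mk₀ hE.cx.f).comp (h'.shortExact.extClass.comp (Ext.mk₀ w) (add_comm 1 0))
        (zero_add 1) = ((Ext.mk₀ F.τ₃).comp h'.shortExact.extClass (zero_add 1)).comp
          (Ext.mk₀ w) (add_zero 1) := by
      rw [Ext.comp_assoc_of_third_deg_zero]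
    rw [this, ← nat, Ext.comp_assoc_of_third_deg_zero, Ext.mk₀_comp_mk₀]
    exact add_neg_cancel _
  obtain ⟨y, hy⟩ := Ext.contravariant_sequence_exact₁ h.shortExact (ModuleCat.of R Y) _
    (add_comm 1 0) e1
  obtain ⟨y, rfl⟩ := (Ext.mk₀_bijective _ _).2 y
  rw [Ext.mk₀_comp_mk₀] at hy
  have hy := congrArg ModuleCat.Hom.hom ((Ext.mk₀_bijective _ _).1 hy)
  refine ⟨w.hom, y.hom, ?_⟩
  have h2 : y.hom.comp f = φ - w.hom.comp a := hy
  rw [h2]; abel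

end ExtInterface

section DerivedShift

open Limits

universe v u v' u'

variable {C : Type u} [Category.{v} C] [Abelian C] {S : ShortComplex C} {Z : C}

/-- The augmentation of a projective resolution. -/
noncomputable def CategoryTheory.ProjectiveResolution.augmentation (Q : ProjectiveResolution Z) :
    Q.complex.X 0 ⟶ Z := Q.π.f 0

instance (Q : ProjectiveResolution Z) : Epi Q.augmentation := inferInstanceAs (Epi (Q.π.f 0))

lemma CategoryTheory.ProjectiveResolution.d_augmentation (Q : ProjectiveResolution Z) :
    Q.complex.d 1 0 ≫ Q.augmentation = 0 := Q.complex_d_comp_π_f_zero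

lemma CategoryTheory.ProjectiveResolution.exact_augmentation (Q : ProjectiveResolution Z) :
    (ShortComplex.mk _ _ Q.d_augmentation).Exact := Q.exact₀

lemma CategoryTheory.ProjectiveResolution.d_augmentation_comp (Q : ProjectiveResolution S.X₁) :
    Q.complex.d 1 0 ≫ Q.augmentation ≫ S.f = 0 := by
  rw [← Category.assoc, Q.d_augmentation, zero_comp]

lemma CategoryTheory.ProjectiveResolution.augmentation_comp_comp (Q : ProjectiveResolution S.X₁) :
    (Q.augmentation ≫ S.f) ≫ S.g = 0 := by
  rw [Category.assoc, S.zero, comp_zero]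

/-- Splicing a projective resolution of `S.X₁` with a short exact sequence. -/
noncomputable abbrev spliceComplex (S : ShortComplex C) (Q : ProjectiveResolution S.X₁) :
    ChainComplex C ℕ :=
  ChainComplex.augment Q.complex (Q.augmentation ≫ S.f) Q.d_augmentation_comp

lemma splice_exact_zero (hS : S.ShortExact) (Q : ProjectiveResolution S.X₁) :
    (ShortComplex.mk (Q.augmentation ≫ S.f) S.g Q.augmentation_comp_comp).Exact := by
  let φ : ShortComplex.mk (Q.augmentation ≫ S.f) S.g Q.augmentation_comp_comp ⟶ S :=
    { τ₁ := Q.augmentation, τ₂ := 𝟙 _, τ₃ := 𝟙 _ }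
  have : Epi φ.τ₁ := inferInstanceAs (Epi Q.augmentation)
  have : IsIso φ.τ₂ := inferInstanceAs (IsIso (𝟙 _))
  have : Mono φ.τ₃ := inferInstanceAs (Mono (𝟙 _))
  exact (ShortComplex.exact_iff_of_epi_of_isIso_of_mono φ).2 hS.exact

lemma splice_exact_one (hS : S.ShortExact) (Q : ProjectiveResolution S.X₁) :
    (ShortComplex.mk (Q.complex.d 1 0) (Q.augmentation ≫ S.f) Q.d_augmentation_comp).Exact := by
  have := hS.mono_f
  let φ : ShortComplex.mk _ _ Q.d_augmentation ⟶
      ShortComplex.mk (Q.complex.d 1 0) (Q.augmentation ≫ S.f) Q.d_augmentation_comp :=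
    { τ₁ := 𝟙 _, τ₂ := 𝟙 _, τ₃ := S.f }
  have : Epi φ.τ₁ := inferInstanceAs (Epi (𝟙 _))
  have : IsIso φ.τ₂ := inferInstanceAs (IsIso (𝟙 _))
  have : Mono φ.τ₃ := inferInstanceAs (Mono S.f)
  exact (ShortComplex.exact_iff_of_epi_of_isIso_of_mono φ).1 Q.exact_augmentation

/-- The spliced projective resolution. -/
noncomputable def spliceResolution (hS : S.ShortExact) [Projective S.X₂]
    (Q : ProjectiveResolution S.X₁) : ProjectiveResolution S.X₃ where
  complex := spliceComplex S Q
  projective n := by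
    cases n
    · assumption
    · exact Q.projective _
  π := (ChainComplex.toSingle₀Equiv _ _).symm ⟨S.g, Q.augmentation_comp_comp⟩
  quasiIso := ⟨fun n => by
    have := hS.epi_g
    cases n with
    | zero =>
      rw [ChainComplex.quasiIsoAt₀_iff, ShortComplex.quasiIso_iff_of_zeros']
      · dsimp
        refine (ShortComplex.exact_and_epi_g_iff_of_iso ?_).2
          ⟨splice_exact_zero hS Q, by dsimp; infer_instance⟩
        refine ShortComplex.isoMk (Iso.refl _) (Iso.refl _) (Iso.refl _)
          ((Category.id_comp _).trans (Category.comp_id _).symm)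
          ((Category.id_comp _).trans (Eq.trans ?_ (Category.comp_id _).symm))
        exact (ChainComplex.toSingle₀Equiv_symm_apply_f_zero (C := spliceComplex S Q) S.g
          Q.augmentation_comp_comp).symm
      all_goals rfl
    | succ m =>
      rw [quasiIsoAt_iff_exactAt' (hL := ChainComplex.exactAt_succ_single_obj ..),
          HomologicalComplex.exactAt_iff' _ (m + 2) (m + 1) m (by simp) (by simp)]
      cases m with
      | zero => exact splice_exact_one hS Q
      | succ m => exact Q.exact_succ m⟩

variable {D : Type u'} [Category.{v'} D] [Abelian D] [HasProjectiveResolutions C]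
  (F : C ⥤ D) [F.Additive]

lemma isZero_leftDerived_iff (n : ℕ) (P : ProjectiveResolution Z) :
    IsZero ((F.leftDerived (n + 1)).obj Z) ↔
      (ShortComplex.mk (F.map (P.complex.d (n + 2) (n + 1))) (F.map (P.complex.d (n + 1) n))
        (by rw [← F.map_comp, P.complex.d_comp_d, F.map_zero])).Exact := by
  rw [(P.isoLeftDerivedObj F (n + 1)).isZero_iff]
  erw [← HomologicalComplex.exactAt_iff_isZero_homology]
  rw [HomologicalComplex.exactAt_iff' _ (n + 2) (n + 1) n (by simp) (by simp)]
  rfl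

lemma isZero_leftDerived_shift (hS : S.ShortExact) [Projective S.X₂] (n : ℕ) :
    IsZero ((F.leftDerived (n + 2)).obj S.X₃) ↔ IsZero ((F.leftDerived (n + 1)).obj S.X₁) := by
  let Q := projectiveResolution S.X₁
  rw [isZero_leftDerived_iff F (n + 1) (spliceResolution hS Q), isZero_leftDerived_iff F n Q]
  rfl

lemma isZero_leftDerived_one_iff [PreservesFiniteColimits F] (hS : S.ShortExact)
    [Projective S.X₂] :
    IsZero ((F.leftDerived 1).obj S.X₃) ↔ Mono (F.map S.f) := by
  let Q := projectiveResolution S.X₁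
  rw [isZero_leftDerived_iff F 0 (spliceResolution hS Q)]
  have h1 := Q.exact_augmentation.map_of_epi_of_preservesCokernel F
    (inferInstanceAs (Epi Q.augmentation)) inferInstance
  let φ : (ShortComplex.mk _ _ Q.d_augmentation).map F ⟶
      (ShortComplex.mk (Q.complex.d 1 0) (Q.augmentation ≫ S.f) Q.d_augmentation_comp).map F :=
    { τ₁ := 𝟙 (F.obj (Q.complex.X 1)), τ₂ := 𝟙 (F.obj (Q.complex.X 0)), τ₃ := F.map S.f
      comm₁₂ := (Category.id_comp _).trans (Category.comp_id _).symm
      comm₂₃ := (Category.id_comp _).trans (F.map_comp _ _) }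
  have e1 : Epi φ.τ₁ := inferInstanceAs (Epi (𝟙 _))
  have e2 : IsIso φ.τ₂ := inferInstanceAs (IsIso (𝟙 _))
  constructor
  · intro h
    have h2 : ((ShortComplex.mk (Q.complex.d 1 0) (Q.augmentation ≫ S.f)
      Q.d_augmentation_comp).map F).Exact := h
    have e3 : Epi (F.map Q.augmentation) := inferInstance
    rw [Preadditive.mono_iff_cancel_zero]
    intro P g hg
    obtain ⟨A, π, hπ, x, hx⟩ := surjective_up_to_refinements_of_epi (F.map Q.augmentation) g
    have h3 : x ≫ F.map (Q.augmentation ≫ S.f) = 0 := by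
      rw [F.map_comp, ← Category.assoc, ← hx, Category.assoc, hg, comp_zero]
    obtain ⟨A', π', hπ', y, hy⟩ : ∃ (A' : D) (π' : A' ⟶ A) (_ : Epi π')
        (y : A' ⟶ F.obj (Q.complex.X 1)), π' ≫ x = y ≫ F.map (Q.complex.d 1 0) :=
      h2.exact_up_to_refinements x h3
    rw [← cancel_epi π, ← cancel_epi π', hx, ← Category.assoc, hy,
      Category.assoc, ← F.map_comp, Q.d_augmentation]
    simp
  · intro h
    have e3 : Mono φ.τ₃ := h
    exact (ShortComplex.exact_iff_of_epi_of_isIso_of_mono φ).1 h1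

end DerivedShift

section ExtTor

open Limits Opposite

variable {R : Type} [CommRing R] {A B C X Y : Type} [AddCommGroup A] [Module R A]
  [AddCommGroup B] [Module R B] [AddCommGroup C] [Module R C]
  [AddCommGroup X] [Module R X] [AddCommGroup Y] [Module R Y]
  {f : A →ₗ[R] B} {g : B →ₗ[R] C}

instance (N : ModuleCat.{0} R) :
    PreservesFiniteLimits ((linearYoneda R (ModuleCat.{0} R)).obj N) := by
  have : PreservesLimits ((linearYoneda R (ModuleCat.{0} R)).obj N ⋙ forget (ModuleCat R)) :=
    inferInstanceAs (PreservesLimits (yoneda.obj N))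
  have : PreservesLimits ((linearYoneda R (ModuleCat.{0} R)).obj N) :=
    preservesLimits_of_reflects_of_preserves _ (forget (ModuleCat R))
  infer_instance

instance (N : ModuleCat.{0} R) :
    PreservesFiniteColimits ((linearYoneda R (ModuleCat.{0} R)).obj N).rightOp :=
  preservesFiniteColimits_rightOp _

lemma subsingleton_extGroup_iff (i : ℕ) (M N : ModuleCat.{0} R) :
    Subsingleton (ExtGroup R i M N) ↔
      IsZero ((((linearYoneda R (ModuleCat.{0} R)).obj N).rightOp.leftDerived i).obj M) := by
  rw [← ModuleCat.isZero_iff_subsingleton]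
  exact ⟨fun h => h.op, fun h => h.unop⟩

lemma subsingleton_torGroup_iff (i : ℕ) (M N : ModuleCat.{0} R) :
    Subsingleton (TorGroup R i M N) ↔
      IsZero ((((MonoidalCategory.tensoringLeft (ModuleCat.{0} R)).obj M).leftDerived i).obj N) := by
  rw [← ModuleCat.isZero_iff_subsingleton]
  rfl

lemma IsSES.subsingleton_extGroup_succ_succ_iff (h : IsSES f g) [Module.Projective R B] (i : ℕ) :
    Subsingleton (ExtGroup R (i + 2) (ModuleCat.of R C) (ModuleCat.of R Y)) ↔
      Subsingleton (ExtGroup R (i + 1) (ModuleCat.of R A) (ModuleCat.of R Y)) := by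
  have : Projective h.cx.X₂ := (IsProjective.iff_projective B).mp inferInstance
  rw [subsingleton_extGroup_iff, subsingleton_extGroup_iff]
  exact isZero_leftDerived_shift _ h.shortExact i

lemma IsSES.subsingleton_torGroup_succ_succ_iff (h : IsSES f g) [Module.Projective R B] (i : ℕ) :
    Subsingleton (TorGroup R (i + 2) (ModuleCat.of R X) (ModuleCat.of R C)) ↔
      Subsingleton (TorGroup R (i + 1) (ModuleCat.of R X) (ModuleCat.of R A)) := by
  have : Projective h.cx.X₂ := (IsProjective.iff_projective B).mp inferInstance
  rw [subsingleton_torGroup_iff, subsingleton_torGroup_iff]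
  exact isZero_leftDerived_shift _ h.shortExact i

lemma IsSES.subsingleton_extGroup_one_iff (h : IsSES f g) [Module.Projective R B] :
    Subsingleton (ExtGroup R 1 (ModuleCat.of R C) (ModuleCat.of R Y)) ↔
      ∀ φ : A →ₗ[R] Y, ∃ ψ : B →ₗ[R] Y, ψ.comp f = φ := by
  have : Projective h.cx.X₂ := (IsProjective.iff_projective B).mp inferInstance
  rw [subsingleton_extGroup_iff]
  refine (isZero_leftDerived_one_iff _ h.shortExact).trans ?_
  have e1 : Mono (((linearYoneda R (ModuleCat.{0} R)).obj (ModuleCat.of R Y)).rightOp.map h.cx.f) ↔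
      Epi (((linearYoneda R (ModuleCat.{0} R)).obj (ModuleCat.of R Y)).map h.cx.f.op) :=
    ⟨fun h => @unop_epi_of_mono _ _ _ _ _ h, fun h => @op_mono_of_epi _ _ _ _ _ h⟩
  rw [e1, ModuleCat.epi_iff_surjective]
  constructor
  · intro H φ
    obtain ⟨ψ, hψ⟩ := H (ModuleCat.ofHom φ)
    exact ⟨ψ.hom, congrArg ModuleCat.Hom.hom hψ⟩
  · intro H φ
    obtain ⟨ψ, hψ⟩ := H (ModuleCat.Hom.hom φ)
    exact ⟨ModuleCat.ofHom ψ, ModuleCat.hom_ext hψ⟩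

lemma IsSES.subsingleton_torGroup_one_iff (h : IsSES f g) [Module.Projective R B] :
    Subsingleton (TorGroup R 1 (ModuleCat.of R X) (ModuleCat.of R C)) ↔
      Function.Injective (f.lTensor X) := by
  have : Projective h.cx.X₂ := (IsProjective.iff_projective B).mp inferInstance
  rw [subsingleton_torGroup_iff]
  refine (isZero_leftDerived_one_iff _ h.shortExact).trans ?_
  rw [ModuleCat.mono_iff_injective]
  rfl

/-- The canonical presentation of a module. -/
lemma exists_isSES_projective (X : Type) [AddCommGroup X] [Module R X] :
    ∃ (K P : Type) (_ : AddCommGroup K) (_ : Module R K) (_ : AddCommGroup P) (_ : Module R P)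
      (_ : Module.Projective R P) (f : K →ₗ[R] P) (g : P →ₗ[R] X), IsSES f g := by
  let p : (X →₀ R) →ₗ[R] X := Finsupp.linearCombination R id
  refine ⟨LinearMap.ker p, X →₀ R, inferInstance, inferInstance, inferInstance, inferInstance,
    inferInstance, (LinearMap.ker p).subtype, p, Subtype.val_injective,
    LinearMap.exact_subtype_ker_map p, Finsupp.linearCombination_id_surjective R X⟩

lemma subsingleton_extGroup_iff_extVanish (i : ℕ) (M N : Type) [AddCommGroup M] [Module R M]
    [AddCommGroup N] [Module R N] :
    Subsingleton (ExtGroup R (i + 1) (ModuleCat.of R M) (ModuleCat.of R N)) ↔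
      ExtVanish R (i + 1) M N := by
  induction i generalizing M with
  | zero =>
    obtain ⟨K, P, _, _, _, _, _, f, g, h⟩ := exists_isSES_projective (R := R) M
    rw [h.subsingleton_extGroup_one_iff]
    exact ⟨h.extVanish_one (extVanish_of_projective P 0), fun H φ => h.exists_extend H φ⟩
  | succ i ih =>
    obtain ⟨K, P, _, _, _, _, _, f, g, h⟩ := exists_isSES_projective (R := R) M
    rw [h.subsingleton_extGroup_succ_succ_iff, ih]
    exact ⟨fun H => h.extVanish_right H (extVanish_of_projective P _),
      fun H => h.extVanish_left (extVanish_of_projective P _) H⟩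

end ExtTor

section TorInterface

open TensorProduct

variable {R : Type} [CommRing R] {A B C X Y P Λ L F : Type} [AddCommGroup A] [Module R A]
  [AddCommGroup B] [Module R B] [AddCommGroup C] [Module R C]
  [AddCommGroup X] [Module R X] [AddCommGroup Y] [Module R Y]
  [AddCommGroup P] [Module R P] [AddCommGroup Λ] [Module R Λ]
  [AddCommGroup L] [Module R L] [AddCommGroup F] [Module R F]

/-- Vanishing of all higher Tor groups of unbundled modules. -/
def TorVanish (R : Type) [CommRing R] (M N : Type) [AddCommGroup M] [Module R M]
    [AddCommGroup N] [Module R N] : Prop :=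
  ∀ i : ℕ, Subsingleton (TorGroup R (i + 1) (ModuleCat.of R M) (ModuleCat.of R N))

lemma IsSES.torVanish_iff {f : A →ₗ[R] P} {g : P →ₗ[R] B} (h : IsSES f g)
    [Module.Projective R P] :
    TorVanish R X B ↔ Function.Injective (f.lTensor X) ∧ TorVanish R X A := by
  constructor
  · exact fun H => ⟨h.subsingleton_torGroup_one_iff.1 (H 0),
      fun i => (h.subsingleton_torGroup_succ_succ_iff i).1 (H (i + 1))⟩
  · rintro ⟨h0, h1⟩ i
    cases i with
    | zero => exact h.subsingleton_torGroup_one_iff.2 h0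
    | succ i => exact (h.subsingleton_torGroup_succ_succ_iff i).2 (h1 i)

lemma torVanish_of_projective [Module.Projective R P] : TorVanish R X P := by
  have : Projective (ModuleCat.of R P) := (IsProjective.iff_projective P).mp inferInstance
  intro i
  rw [subsingleton_torGroup_iff]
  exact isZero_Tor_succ_of_projective (ModuleCat.{0} R) _ _ i

lemma rTensor_lTensor_comm (f : A →ₗ[R] B) (g : X →ₗ[R] Y) (z : A ⊗[R] X) :
    f.rTensor Y (g.lTensor A z) = g.lTensor B (f.rTensor X z) := by
  rw [← LinearMap.comp_apply, ← LinearMap.comp_apply, LinearMap.rTensor_comp_lTensor,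
    LinearMap.lTensor_comp_rTensor]

/-- The snake argument behind the symmetry of `Tor₁`. -/
lemma IsSES.rTensor_injective {a : Λ →ₗ[R] P} {b : P →ₗ[R] A} (h : IsSES a b)
    {f : L →ₗ[R] F} {g : F →ₗ[R] B} (h' : IsSES f g) [Module.Flat R F]
    (H : Function.Injective (f.lTensor A)) : Function.Injective (a.rTensor B) := by
  rw [injective_iff_map_eq_zero]
  intro z hz
  obtain ⟨u, rfl⟩ := LinearMap.lTensor_surjective Λ h'.surj z
  rw [rTensor_lTensor_comm] at hz
  obtain ⟨v, hv⟩ := (lTensor_exact P h'.exact h'.surj _).1 hz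
  have h1 : f.lTensor A (b.rTensor L v) = 0 := by
    rw [← rTensor_lTensor_comm, hv]
    exact (rTensor_exact F h.exact h.surj).apply_apply_eq_zero u
  obtain ⟨w, rfl⟩ := (rTensor_exact L h.exact h.surj _).1 ((injective_iff_map_eq_zero _).1 H _ h1)
  rw [← rTensor_lTensor_comm] at hv
  rw [← Module.Flat.rTensor_preserves_injective_linearMap a h.inj hv]
  exact (lTensor_exact Λ h'.exact h'.surj).apply_apply_eq_zero w

lemma IsSES.rTensor_injective_of_torVanish {a : Λ →ₗ[R] P} {b : P →ₗ[R] A} (h : IsSES a b)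
    (H : TorVanish R A B) : Function.Injective (a.rTensor B) := by
  obtain ⟨K, Q, _, _, _, _, _, f, g, h'⟩ := exists_isSES_projective (R := R) B
  exact h.rTensor_injective h' (h'.torVanish_iff.1 H).1

lemma IsSES.torVanish_left {a : Λ →ₗ[R] P} {b : P →ₗ[R] A} (h : IsSES a b) [Module.Flat R P]
    (H : TorVanish R A B) : TorVanish R Λ B := by
  intro i
  induction i generalizing B with
  | zero =>
    obtain ⟨K, Q, _, _, _, _, _, f, g, h'⟩ := exists_isSES_projective (R := R) B
    refine h'.subsingleton_torGroup_one_iff.2 ?_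
    have h1 := (h'.torVanish_iff.1 H).2
    have h2 : Function.Injective (a.rTensor Q ∘ₗ f.lTensor Λ) := by
      rw [LinearMap.rTensor_comp_lTensor, ← LinearMap.lTensor_comp_rTensor]
      exact (Module.Flat.lTensor_preserves_injective_linearMap f h'.inj).comp
        (h.rTensor_injective_of_torVanish h1)
    exact Function.Injective.of_comp h2
  | succ i ih =>
    obtain ⟨K, Q, _, _, _, _, _, f, g, h'⟩ := exists_isSES_projective (R := R) B
    exact (h'.subsingleton_torGroup_succ_succ_iff i).2 (ih (h'.torVanish_iff.1 H).2)

lemma IsSES.lTensor {f : A →ₗ[R] B} {g : B →ₗ[R] C} (h : IsSES f g)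
    (H : Function.Injective (f.lTensor X)) : IsSES (f.lTensor X) (g.lTensor X) :=
  ⟨H, lTensor_exact X h.exact h.surj, LinearMap.lTensor_surjective X h.surj⟩

lemma IsSES.rTensor {f : A →ₗ[R] B} {g : B →ₗ[R] C} (h : IsSES f g)
    (H : Function.Injective (f.rTensor X)) : IsSES (f.rTensor X) (g.rTensor X) :=
  ⟨H, rTensor_exact X h.exact h.surj, LinearMap.rTensor_surjective X h.surj⟩

lemma exists_isSES_fin (R X : Type) [CommRing R] [AddCommGroup X] [Module R X]
    [Module.Finite R X] :
    ∃ (m : ℕ) (K : Submodule R (Fin m → R)) (g : (Fin m → R) →ₗ[R] X), IsSES K.subtype g := by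
  obtain ⟨m, g, hg⟩ := Module.Finite.exists_fin' R X
  exact ⟨m, LinearMap.ker g, g, Subtype.val_injective, LinearMap.exact_subtype_ker_map g, hg⟩

end TorInterface

section DualityBound

open RingTheory.Sequence
open scoped Pointwise

variable {R : Type} [CommRing R] {M N : Type} [AddCommGroup M] [Module R M]
  [AddCommGroup N] [Module R N]

/-- All `Ext^i(M, R)` with `i > n` vanish. -/
def DualExtVanishAbove (R : Type) [CommRing R] (n : ℕ) (M : Type) [AddCommGroup M]
    [Module R M] : Prop :=
  ∀ i > n, ExtVanish R i M R

/-- `n` is the largest index with `Ext^n(M, R) ≠ 0`. -/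
def HasDualExtTop (R : Type) [CommRing R] (n : ℕ) (M : Type) [AddCommGroup M]
    [Module R M] : Prop :=
  DualExtVanishAbove R n M ∧ ¬ ExtVanish R n M R

lemma extVanish_of_prime_quotients [IsNoetherianRing R] (J : Ideal R) (i : ℕ)
    (H : ∀ q : Ideal R, q.IsPrime → J ≤ q → ExtVanish R i (R ⧸ q) N) [hM : Module.Finite R M]
    (hJ : ∀ x ∈ J, ∀ m : M, x • m = 0) : ExtVanish R i M N := by
  revert hJ
  refine IsNoetherianRing.induction_on_isQuotientEquivQuotientPrime R hM
    (motive := fun M _ _ _ => (∀ x ∈ J, ∀ m : M, x • m = 0) → ExtVanish R i M N) ?_ ?_ ?_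
  · intro M _ _ _ _ _
    exact extVanish_of_subsingleton i
  · intro M _ _ _ p e h
    refine extVanish_congr e.symm i (H p.asIdeal p.isPrime fun x hx => ?_)
    have h1 := congrArg e (h x hx (e.symm 1))
    rw [map_smul, e.apply_symm_apply, map_zero, ← map_one (Ideal.Quotient.mk p.asIdeal),
      ← Ideal.Quotient.mk_eq_mk, ← Submodule.Quotient.mk_smul, smul_eq_mul, mul_one,
      Ideal.Quotient.mk_eq_mk] at h1
    exact Ideal.Quotient.eq_zero_iff_mem.1 h1
  · intro A _ _ _ B _ _ _ C _ _ _ f g hf hg hfg hA hC h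
    refine IsSES.extVanish_middle ⟨hf, hfg, hg⟩ (hC fun x hx m => ?_) (hA fun x hx m => hf ?_)
    · obtain ⟨b, rfl⟩ := hg m
      rw [← map_smul, h x hx, map_zero]
    · rw [map_smul, h x hx, map_zero]

lemma isSMulRegular_quotient_prime {p : Ideal R} [p.IsPrime] {x : R} (hx : x ∉ p) :
    IsSMulRegular (R ⧸ p) x := by
  intro a b hab
  obtain ⟨a, rfl⟩ := Ideal.Quotient.mk_surjective a
  obtain ⟨b, rfl⟩ := Ideal.Quotient.mk_surjective b
  have h1 : Ideal.Quotient.mk p (x * a) = Ideal.Quotient.mk p (x * b) := hab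
  rw [Ideal.Quotient.mk_eq_mk_iff_sub_mem, ← mul_sub] at h1
  exact (Ideal.Quotient.mk_eq_mk_iff_sub_mem _ _).2
    ((Ideal.IsPrime.mem_or_mem ‹_› h1).resolve_left hx)

lemma extVanish_zero_of_surjective {f : M →ₗ[R] N} (hf : Function.Surjective f) {Y : Type}
    [AddCommGroup Y] [Module R Y] (h : ExtVanish R 0 M Y) : ExtVanish R 0 N Y := by
  rw [extVanish_zero_iff] at h ⊢
  refine ⟨fun a b => ?_⟩
  rw [← LinearMap.cancel_right hf]
  exact Subsingleton.elim _ _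

lemma HasDualExtTop.unique {m n : ℕ} (hm : HasDualExtTop R m M) (hn : HasDualExtTop R n M) :
    m = n := by
  by_contra hne
  rcases lt_or_gt_of_ne hne with h | h
  exacts [hn.2 (hm.1 n h), hm.2 (hn.1 m h)]

variable [IsLocalRing R]

lemma exists_mem_maximalIdeal_notMem {p : Ideal R} [p.IsPrime] (hp : p ≠ maximalIdeal R) :
    ∃ x ∈ maximalIdeal R, x ∉ p := by
  by_contra! h
  exact hp (le_antisymm (le_maximalIdeal (Ideal.IsPrime.ne_top ‹_›)) h)

lemma extVanish_prime_of_extVanish_residue [IsNoetherianRing R] [Module.Finite R N] {t : ℕ}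
    (H : ∀ i ≥ t, ExtVanish R i (R ⧸ maximalIdeal R) N) (p : Ideal R) (hp : p.IsPrime) :
    ∀ i ≥ t, ExtVanish R i (R ⧸ p) N := by
  induction p using WellFoundedGT.induction with
  | ind p ih =>
  intro i hi
  by_cases hpm : p = maximalIdeal R
  · subst hpm; exact H i hi
  obtain ⟨x, hx, hxp⟩ := exists_mem_maximalIdeal_notMem hpm
  refine (isSMulRegular_quotient_prime hxp).isSES.extVanish_of_lsmul hx
    (extVanish_of_prime_quotients (p ⊔ Ideal.span {x}) (i + 1) (fun q hq hpq => ?_) ?_)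
  · refine ih q (lt_of_le_of_ne (le_sup_left.trans hpq) ?_) hq (i + 1) (by omega)
    rintro rfl
    exact hxp (hpq (Ideal.mem_sup_right (Ideal.mem_span_singleton_self x)))
  · intro y hy m
    have h1 : p ⊔ Ideal.span {x} ≤
        Module.annihilator R ((R ⧸ p) ⧸ (x • (⊤ : Submodule R (R ⧸ p)))) := by
      refine sup_le (fun y hy => ?_) ((Ideal.span_singleton_le_iff_mem _).2 ?_)
      · rw [Module.mem_annihilator]
        intro m
        obtain ⟨m, rfl⟩ := Submodule.Quotient.mk_surjective _ m
        obtain ⟨m, rfl⟩ := Ideal.Quotient.mk_surjective m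
        rw [← Submodule.Quotient.mk_smul]
        have : y • (Ideal.Quotient.mk p m) = 0 :=
          Ideal.Quotient.eq_zero_iff_mem.2 (Ideal.mul_mem_right _ _ hy)
        rw [this, Submodule.Quotient.mk_zero]
      · rw [Module.mem_annihilator]
        intro m
        obtain ⟨m, rfl⟩ := Submodule.Quotient.mk_surjective _ m
        rw [← Submodule.Quotient.mk_smul]
        exact (Submodule.Quotient.mk_eq_zero _).2
          (Submodule.smul_mem_pointwise_smul _ _ _ Submodule.mem_top)
    exact Module.mem_annihilator.1 (h1 hy) m

lemma extVanish_of_extVanish_residue [IsNoetherianRing R] [Module.Finite R N] {t : ℕ}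
    (H : ∀ i ≥ t, ExtVanish R i (R ⧸ maximalIdeal R) N) [Module.Finite R M] :
    ∀ i ≥ t, ExtVanish R i M N := fun i hi =>
  extVanish_of_prime_quotients ⊥ i
    (fun q hq _ => extVanish_prime_of_extVanish_residue H q hq i hi)
    fun x hx m => by rw [(Submodule.mem_bot R).1 hx, zero_smul]

lemma exists_hasDualExtTop_residue [IsNoetherianRing R] (h : IsGorensteinLocalRing R) :
    ∃ s : ℕ, HasDualExtTop R s (R ⧸ maximalIdeal R) := by
  classical
  have h1 : ∃ t : ℕ, ∀ i ≥ t, ExtVanish R i (R ⧸ maximalIdeal R) R := by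
    obtain ⟨t, ht⟩ := h
    refine ⟨t + 1, fun i hi => ?_⟩
    obtain ⟨j, rfl⟩ : ∃ j, i = j + 1 := ⟨i - 1, by omega⟩
    exact (subsingleton_extGroup_iff_extVanish j _ _).1 (ht (j + 1) (by omega))
  have h2 := Nat.find_spec h1
  have h3 := fun m hm => Nat.find_min h1 (m := m) hm
  generalize Nat.find h1 = t at h2 h3
  cases t with
  | zero =>
    have h4 := extVanish_zero_iff.1 (extVanish_of_extVanish_residue (M := R) h2 0 le_rfl)
    exact absurd (DFunLike.congr_fun (Subsingleton.elim (LinearMap.id : R →ₗ[R] R) 0) 1) one_ne_zero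
  | succ s =>
    refine ⟨s, fun i hi => h2 i hi, fun h4 => h3 s (by omega) fun i hi => ?_⟩
    rcases eq_or_lt_of_le hi with rfl | hi
    · exact h4
    · exact h2 i hi

lemma HasDualExtTop.dualExtVanishAbove [IsNoetherianRing R] {s : ℕ}
    (h : HasDualExtTop R s (R ⧸ maximalIdeal R)) [Module.Finite R M] :
    DualExtVanishAbove R s M := fun i hi =>
  extVanish_of_extVanish_residue (t := s + 1) (fun i hi => h.1 i hi) i hi

/-- Either `M` contains the residue field, or some element of the maximal ideal is regular on `M`. -/
lemma exists_residue_injective_or_isSMulRegular [IsNoetherianRing R] (M : Type) [AddCommGroup M]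
    [Module R M] [Module.Finite R M] :
    (∃ f : (R ⧸ maximalIdeal R) →ₗ[R] M, Function.Injective f) ∨
      ∃ x ∈ maximalIdeal R, IsSMulRegular M x := by
  by_cases h : Subsingleton ((R ⧸ maximalIdeal R) →ₗ[R] M)
  · obtain ⟨x, hx, hxM⟩ := IsSMulRegular.subsingleton_linearMap_iff.1 h
    rw [Ideal.annihilator_quotient] at hx
    exact Or.inr ⟨x, hx, hxM⟩
  · rw [not_subsingleton_iff_nontrivial] at h
    obtain ⟨f, hf⟩ := exists_ne (0 : (R ⧸ maximalIdeal R) →ₗ[R] M)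
    have : IsSimpleModule R (R ⧸ maximalIdeal R) :=
      isSimpleModule_iff_isCoatom.2 (maximalIdeal.isMaximal R).out
    exact Or.inl ⟨f, LinearMap.injective_of_ne_zero hf⟩

lemma HasDualExtTop.not_extVanish_of_injective [IsNoetherianRing R] {s : ℕ}
    (h : HasDualExtTop R s (R ⧸ maximalIdeal R)) [Module.Finite R M]
    {f : (R ⧸ maximalIdeal R) →ₗ[R] M} (hf : Function.Injective f) : ¬ ExtVanish R s M R := by
  intro hM
  have h1 : IsSES f (LinearMap.range f).mkQ :=
    ⟨hf, LinearMap.exact_map_mkQ_range f, Submodule.mkQ_surjective _⟩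
  exact h.2 (h1.extVanish_left hM (h.dualExtVanishAbove (s + 1) (by omega)))

lemma IsSMulRegular.not_extVanish_succ [IsNoetherianRing R] [Module.Finite R M] {x : R}
    (hx : x ∈ maximalIdeal R) (hM : IsSMulRegular M x) {n : ℕ} (h : ¬ ExtVanish R n M R) :
    ¬ ExtVanish R (n + 1) (QuotSMulTop x M) R := fun h1 =>
  h (hM.isSES.extVanish_of_lsmul hx h1)

lemma HasDualExtTop.length_add_le [IsNoetherianRing R] {s : ℕ}
    (h : HasDualExtTop R s (R ⧸ maximalIdeal R)) (rs : List R) :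
    ∀ (M : Type) [AddCommGroup M] [Module R M] [Module.Finite R M] {n : ℕ},
    ¬ ExtVanish R n M R → (∀ r ∈ rs, r ∈ maximalIdeal R) → IsWeaklyRegular M rs →
    rs.length + n ≤ s := by
  induction rs with
  | nil =>
    intro M _ _ _ n hn _ _
    by_contra! hlt
    exact hn (h.dualExtVanishAbove n (by simpa using hlt))
  | cons x rs ih =>
    intro M _ _ _ n hn hrs hM
    rw [isWeaklyRegular_cons_iff] at hM
    have := ih (QuotSMulTop x M) (hM.1.not_extVanish_succ (hrs x (by simp)) hn)
      (fun r hr => hrs r (by simp [hr])) hM.2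
    simp only [List.length_cons]
    omega

lemma HasDualExtTop.exists_isRegular [IsNoetherianRing R] {s : ℕ}
    (h : HasDualExtTop R s (R ⧸ maximalIdeal R)) (M : Type) [AddCommGroup M] [Module R M]
    [Module.Finite R M] [Nontrivial M] :
    ∃ (n : ℕ) (rs : List R), HasDualExtTop R n M ∧ (∀ r ∈ rs, r ∈ maximalIdeal R) ∧
      IsRegular M rs ∧ rs.length + n = s := by
  suffices H : ∀ (K : Submodule R M) (Q : Type) [AddCommGroup Q] [Module R Q] [Module.Finite R Q]
      [Nontrivial Q] (π : M →ₗ[R] Q), Function.Surjective π → LinearMap.ker π = K →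
      ∃ (n : ℕ) (rs : List R), HasDualExtTop R n Q ∧ (∀ r ∈ rs, r ∈ maximalIdeal R) ∧
      IsRegular Q rs ∧ rs.length + n = s from
    H ⊥ M LinearMap.id Function.surjective_id LinearMap.ker_id
  intro K
  induction K using WellFoundedGT.induction with
  | ind K ih =>
  intro Q _ _ _ _ π hπ hK
  rcases exists_residue_injective_or_isSMulRegular (R := R) Q with ⟨f, hf⟩ | ⟨x, hx, hxQ⟩
  · exact ⟨s, [], ⟨h.dualExtVanishAbove, h.not_extVanish_of_injective hf⟩, by simp,
      IsRegular.nil R Q, by simp⟩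
  · have := nontrivial_quotSMulTop_of_mem_maximalIdeal Q hx
    obtain ⟨n, rs, hn, hrs, hreg, hlen⟩ := ih (LinearMap.ker ((x • ⊤ : Submodule R Q).mkQ ∘ₗ π))
      (by
        subst hK
        refine lt_of_le_of_ne (LinearMap.ker_le_ker_comp _ _) fun heq => ?_
        obtain ⟨q, hq⟩ := exists_ne (0 : Q)
        obtain ⟨m, rfl⟩ := hπ q
        have h1 : x • m ∈ LinearMap.ker ((x • ⊤ : Submodule R Q).mkQ ∘ₗ π) := by
          rw [LinearMap.mem_ker, LinearMap.comp_apply, Submodule.mkQ_apply,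
            Submodule.Quotient.mk_eq_zero, map_smul]
          exact Submodule.smul_mem_pointwise_smul _ _ _ Submodule.mem_top
        rw [← heq, LinearMap.mem_ker, map_smul] at h1
        exact hq (hxQ (h1.trans (smul_zero x).symm))) (QuotSMulTop x Q) _
      ((Submodule.mkQ_surjective _).comp hπ) rfl
    have hses := hxQ.isSES
    cases n with
    | zero =>
      have h0 : ExtVanish R 0 Q R := hses.extVanish_of_lsmul hx (hn.1 1 one_pos)
      exact absurd (extVanish_zero_of_surjective hses.surj h0) hn.2
    | succ n =>
      have hv : DualExtVanishAbove R n Q := fun i hi =>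
        hses.extVanish_of_lsmul hx (hn.1 (i + 1) (by omega))
      refine ⟨n, x :: rs, ⟨hv, fun h1 => hn.2 (hses.extVanish_right h1 (hv (n + 1) (by omega)))⟩,
        ?_, hreg.cons hxQ, ?_⟩
      · intro r hr
        rcases List.mem_cons.1 hr with rfl | hr
        exacts [hx, hrs r hr]
      · simp only [List.length_cons]
        omega

/-- The Auslander–Bridger formula over a Gorenstein local ring. -/
lemma HasDualExtTop.rdepth_add [IsNoetherianRing R] {s : ℕ}
    (h : HasDualExtTop R s (R ⧸ maximalIdeal R)) [Module.Finite R M] {n : ℕ}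
    (hn : HasDualExtTop R n M) : rdepth R M + n = s := by
  have hnt : Nontrivial M := not_subsingleton_iff_nontrivial.1 fun _ =>
    hn.2 (extVanish_of_subsingleton n)
  obtain ⟨n', rs, hn', hrs, hreg, hlen⟩ := h.exists_isRegular M
  obtain rfl := hn.unique hn'
  have h1 : rdepth R M = rs.length := by
    rw [rdepth, if_neg (not_subsingleton_iff_nontrivial.2 hnt)]
    refine le_antisymm (sSup_le ?_) (le_sSup ⟨rs, rfl, hrs, hreg⟩)
    rintro _ ⟨rs', rfl, hrs', hreg'⟩
    have := h.length_add_le (n := n) rs' M hn.2 hrs' hreg'.toIsWeaklyRegular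
    exact_mod_cast (by omega : rs'.length ≤ rs.length)
  rw [h1, ← hlen]
  push_cast
  rfl

lemma HasDualExtTop.exists_isSMulRegular [IsNoetherianRing R] {s : ℕ}
    (h : HasDualExtTop R s (R ⧸ maximalIdeal R)) (hdim : 0 < ringKrullDim R) :
    ∃ x ∈ maximalIdeal R, IsSMulRegular R x := by
  refine (exists_residue_injective_or_isSMulRegular R).resolve_left ?_
  rintro ⟨f, hf⟩
  have hs : s = 0 := by
    by_contra hs
    obtain ⟨t, rfl⟩ := Nat.exists_eq_succ_of_ne_zero hs
    exact h.not_extVanish_of_injective hf (extVanish_of_projective R t)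
  subst hs
  obtain ⟨p, q, hpq⟩ := Order.krullDim_pos_iff.1 hdim
  have := p.isPrime
  have hp : p.asIdeal ≠ maximalIdeal R := fun hp => by
    have h1 : p.asIdeal < q.asIdeal := hpq
    exact absurd (le_maximalIdeal q.isPrime.ne_top) (hp ▸ h1.not_ge)
  obtain ⟨x, hx, hxp⟩ := exists_mem_maximalIdeal_notMem hp
  have h0 : ExtVanish R 0 (R ⧸ p.asIdeal) R :=
    (isSMulRegular_quotient_prime hxp).isSES.extVanish_of_lsmul hx
      (h.dualExtVanishAbove 1 one_pos)
  have : Nontrivial (R ⧸ p.asIdeal) := Ideal.Quotient.nontrivial_iff.2 p.isPrime.ne_top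
  obtain ⟨n, rs, hn, -, -, hlen⟩ := h.exists_isRegular (R ⧸ p.asIdeal)
  obtain rfl : n = 0 := by omega
  exact hn.2 h0

end DualityBound

section HomDuality

open TensorProduct

variable {R : Type} [CommRing R] {A B C X Y N : Type} [AddCommGroup A] [Module R A]
  [AddCommGroup B] [Module R B] [AddCommGroup C] [Module R C]
  [AddCommGroup X] [Module R X] [AddCommGroup Y] [Module R Y]
  [AddCommGroup N] [Module R N] {f : A →ₗ[R] B} {g : B →ₗ[R] C}

lemma dualExtVanishAbove_congr (e : A ≃ₗ[R] B) {n : ℕ} (h : DualExtVanishAbove R n A) :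
    DualExtVanishAbove R n B := fun i hi => extVanish_congr e i (h i hi)

lemma dualExtVanishAbove_of_projective [Module.Projective R A] (n : ℕ) :
    DualExtVanishAbove R n A := fun i hi => by
  obtain ⟨j, rfl⟩ : ∃ j, i = j + 1 := ⟨i - 1, by omega⟩
  exact extVanish_of_projective A j

lemma IsSES.dualExtVanishAbove_left (h : IsSES f g) {n : ℕ} (hB : DualExtVanishAbove R 0 B)
    (hC : DualExtVanishAbove R n C) : DualExtVanishAbove R (n - 1) A := fun i hi =>
  h.extVanish_left (hB i (by omega)) (hC (i + 1) (by omega))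

lemma IsSES.dualExtVanishAbove_right (h : IsSES f g) {n : ℕ} (hB : DualExtVanishAbove R 0 B)
    (hA : DualExtVanishAbove R n A) : DualExtVanishAbove R (n + 1) C := fun i hi => by
  obtain ⟨j, rfl⟩ : ∃ j, i = j + 1 := ⟨i - 1, by omega⟩
  exact h.extVanish_right (hA j (by omega)) (hB (j + 1) (by omega))

lemma IsSES.hom (h : IsSES f g) (hC : ExtVanish R 1 C Y) :
    IsSES (LinearMap.lcomp R Y g) (LinearMap.lcomp R Y f) := by
  refine ⟨fun a b hab => (LinearMap.cancel_right h.surj).1 hab, fun φ => ⟨fun hφ => ?_, ?_⟩,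
    fun φ => h.exists_extend hC φ⟩
  · have h1 : LinearMap.range f ≤ LinearMap.ker φ := LinearMap.range_le_ker_iff.2 hφ
    rw [← h.exact.linearMap_ker_eq] at h1
    refine ⟨((LinearMap.ker g).liftQ φ h1) ∘ₗ
      (g.quotKerEquivOfSurjective h.surj).symm.toLinearMap, ?_⟩
    ext b
    have : (g.quotKerEquivOfSurjective h.surj).symm (g b) = (LinearMap.ker g).mkQ b := by
      rw [LinearEquiv.symm_apply_eq]; rfl
    simp [LinearMap.lcomp_apply, this]
  · rintro ⟨ψ, rfl⟩
    ext a
    simp [LinearMap.lcomp_apply, h.exact.apply_apply_eq_zero]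

lemma extVanish_succ_left (h : IsSES f g) [Module.Projective R B]
    (H : ∀ i, ExtVanish R (i + 1) C N) (i : ℕ) : ExtVanish R (i + 1) A N :=
  h.extVanish_left (extVanish_of_projective B i) (H (i + 1))

lemma dualExtVanishAbove_hom_fin (hN : DualExtVanishAbove R 0 N) (m : ℕ) :
    DualExtVanishAbove R 0 ((Fin m → R) →ₗ[R] N) := fun i hi =>
  extVanish_congr (LinearEquiv.piRing R N (Fin m) R).symm i (extVanish_pi (hN i hi) m)

/-- The evaluation map `N* ⊗ X → Hom(X, N)*`. -/
noncomputable def dualTensorEval (R N X : Type) [CommRing R] [AddCommGroup N] [Module R N]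
    [AddCommGroup X] [Module R X] :
    Module.Dual R N ⊗[R] X →ₗ[R] Module.Dual R (X →ₗ[R] N) :=
  TensorProduct.lift (LinearMap.mk₂ R (fun f x => f ∘ₗ LinearMap.applyₗ x)
    (fun _ _ _ => rfl) (fun _ _ _ => rfl)
    (fun f x y => by ext φ; simp) (fun c f x => by ext φ; simp))

@[simp] lemma dualTensorEval_tmul (f : Module.Dual R N) (x : X) (φ : X →ₗ[R] N) :
    dualTensorEval R N X (f ⊗ₜ x) φ = f (φ x) := rfl

lemma dualTensorEval_lTensor (f : A →ₗ[R] B) (z : Module.Dual R N ⊗[R] A) :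
    dualTensorEval R N B (f.lTensor _ z) =
      LinearMap.lcomp R R (LinearMap.lcomp R N f) (dualTensorEval R N A z) := by
  induction z with
  | zero => simp
  | tmul g a => rfl
  | add x y hx hy => simp only [map_add, hx, hy]

lemma dualTensorEval_fin_bijective (m : ℕ) :
    Function.Bijective (dualTensorEval R N (Fin m → R)) := by
  classical
  let σ : Module.Dual R ((Fin m → R) →ₗ[R] N) → Module.Dual R N ⊗[R] (Fin m → R) :=
    fun Φ => ∑ i, (Φ ∘ₗ LinearMap.smulRightₗ (LinearMap.proj i)) ⊗ₜ Pi.single i 1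
  have hsum : ∀ x : Fin m → R, ∑ i, x i • (Pi.single i 1 : Fin m → R) = x := fun x => by
    simpa using (pi_eq_sum_univ' x).symm
  refine Function.bijective_iff_has_inverse.2 ⟨σ, fun z => ?_, fun Φ => ?_⟩
  · induction z with
    | zero => simp [σ]
    | tmul f x =>
      conv_rhs => rw [← hsum x, tmul_sum]
      refine Finset.sum_congr rfl fun i _ => ?_
      rw [tmul_smul, smul_tmul']
      congr 1
      ext n
      simp [dualTensorEval]
    | add x y hx hy =>
      rw [map_add]
      conv_rhs => rw [← hx, ← hy]
      simp only [σ, LinearMap.add_comp, add_tmul, Finset.sum_add_distrib]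
  · ext φ
    simp only [σ, map_sum, LinearMap.sum_apply, dualTensorEval_tmul, LinearMap.comp_apply]
    rw [← map_sum]
    congr 1
    refine LinearMap.ext fun x => ?_
    conv_rhs => rw [← hsum x, map_sum]
    simp

lemma dualTensorEval_surjective_of_isSES {m : ℕ} {f : A →ₗ[R] (Fin m → R)}
    {g : (Fin m → R) →ₗ[R] X} (h : IsSES f g) (h1 : ExtVanish R 1 X N)
    (hA : ExtVanish R 1 (A →ₗ[R] N) R) : Function.Surjective (dualTensorEval R N X) := by
  intro Φ
  obtain ⟨Ψ, rfl⟩ := ((h.hom h1).hom hA).surj Φ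
  obtain ⟨z, rfl⟩ := (dualTensorEval_fin_bijective m).2 Ψ
  exact ⟨g.lTensor _ z, dualTensorEval_lTensor g z⟩

lemma dualTensorEval_injective_of_isSES {m : ℕ} {f : A →ₗ[R] (Fin m → R)}
    {g : (Fin m → R) →ₗ[R] X} (h : IsSES f g) (h1 : ExtVanish R 1 X N)
    (hA : ExtVanish R 1 (A →ₗ[R] N) R) (hs : Function.Surjective (dualTensorEval R N A)) :
    Function.Injective (dualTensorEval R N X) := by
  rw [injective_iff_map_eq_zero]
  intro z hz
  obtain ⟨u, rfl⟩ := LinearMap.lTensor_surjective _ h.surj z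
  rw [dualTensorEval_lTensor] at hz
  obtain ⟨w, hw⟩ := (((h.hom h1).hom hA).exact _).1 hz
  obtain ⟨v, rfl⟩ := hs w
  rw [← dualTensorEval_lTensor] at hw
  rw [← (dualTensorEval_fin_bijective m).1 hw]
  exact (lTensor_exact _ h.exact h.surj).apply_apply_eq_zero v

variable [IsLocalRing R] [IsNoetherianRing R] {s : ℕ}

lemma HasDualExtTop.dualExtVanishAbove_hom (hs : HasDualExtTop R s (R ⧸ maximalIdeal R))
    [Module.Finite R X] [Module.Finite R N] (hN : DualExtVanishAbove R 0 N)
    (H : ∀ i, ExtVanish R (i + 1) X N) : DualExtVanishAbove R 0 (X →ₗ[R] N) := by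
  suffices h : ∀ (j : ℕ) (X : Type) [AddCommGroup X] [Module R X] [Module.Finite R X],
      (∀ i, ExtVanish R (i + 1) X N) → DualExtVanishAbove R (s - j) (X →ₗ[R] N) by
    simpa using h s X H
  intro j
  induction j with
  | zero => intro X _ _ _ _; exact hs.dualExtVanishAbove
  | succ j ih =>
    intro X _ _ _ H
    obtain ⟨m, K, g, h⟩ := exists_isSES_fin R X
    exact (h.hom (H 0)).dualExtVanishAbove_left (dualExtVanishAbove_hom_fin hN m)
      (ih K (extVanish_succ_left h H))

lemma HasDualExtTop.dualTensorEval_bijective (hs : HasDualExtTop R s (R ⧸ maximalIdeal R))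
    [Module.Finite R X] [Module.Finite R N] (hN : DualExtVanishAbove R 0 N)
    (H : ∀ i, ExtVanish R (i + 1) X N) : Function.Bijective (dualTensorEval R N X) := by
  have hsurj : ∀ (X : Type) [AddCommGroup X] [Module R X] [Module.Finite R X],
      (∀ i, ExtVanish R (i + 1) X N) → Function.Surjective (dualTensorEval R N X) := by
    intro X _ _ _ H
    obtain ⟨m, K, g, h⟩ := exists_isSES_fin R X
    exact dualTensorEval_surjective_of_isSES h (H 0)
      (hs.dualExtVanishAbove_hom hN (extVanish_succ_left h H) 1 one_pos)
  obtain ⟨m, K, g, h⟩ := exists_isSES_fin R X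
  have hK := extVanish_succ_left h H
  exact ⟨dualTensorEval_injective_of_isSES h (H 0)
    (hs.dualExtVanishAbove_hom hN hK 1 one_pos) (hsurj K hK), hsurj X H⟩

lemma HasDualExtTop.dualExtVanishAbove_dual (hs : HasDualExtTop R s (R ⧸ maximalIdeal R))
    [Module.Finite R X] (hX : DualExtVanishAbove R 0 X) :
    DualExtVanishAbove R 0 (Module.Dual R X) :=
  hs.dualExtVanishAbove_hom (dualExtVanishAbove_of_projective 0) fun i => hX (i + 1) i.succ_pos

lemma HasDualExtTop.bijective_dual_eval (hs : HasDualExtTop R s (R ⧸ maximalIdeal R))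
    [Module.Finite R X] (hX : DualExtVanishAbove R 0 X) :
    Function.Bijective (Module.Dual.eval R X) := by
  have h1 := hs.dualTensorEval_bijective (N := R) (X := X) (dualExtVanishAbove_of_projective 0)
    fun i => hX (i + 1) i.succ_pos
  let e : X ≃ₗ[R] Module.Dual R R ⊗[R] X :=
    (TensorProduct.lid R X).symm.trans
      (TensorProduct.congr (LinearMap.ringLmapEquivSelf R R R).symm (LinearEquiv.refl R X))
  have h2 : (Module.Dual.eval R X : X → _) = dualTensorEval R R X ∘ e := by
    ext x φ
    simp [e]
  rw [h2]
  exact h1.comp e.bijective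

/-- If multiplication by a regular element kills `Ext¹(X, N)` and the higher `Ext` vanish, then
all higher `Tor` of `N*` and `X` vanish. -/
lemma HasDualExtTop.torVanish_dual (hs : HasDualExtTop R s (R ⧸ maximalIdeal R))
    [Module.Finite R X] [Module.Finite R N] (hN : DualExtVanishAbove R 0 N) {x : R}
    (hx : IsSMulRegular R x) (hX : ExtKilled x 1 X N)
    (H : ∀ i, ExtVanish R (i + 2) X N) : TorVanish R (Module.Dual R N) X := by
  intro i
  induction i generalizing X with
  | zero =>
    obtain ⟨m, K, g, h⟩ := exists_isSES_fin R X
    have hK : ∀ i, ExtVanish R (i + 1) K N := fun i =>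
      h.extVanish_left (extVanish_of_projective _ i) (H i)
    refine h.subsingleton_torGroup_one_iff.2 ?_
    rw [injective_iff_map_eq_zero]
    intro z hz
    refine (injective_iff_map_eq_zero _).1 (hs.dualTensorEval_bijective hN hK).1 z ?_
    have h1 := dualTensorEval_lTensor K.subtype z
    rw [hz, map_zero] at h1
    ext φ
    obtain ⟨ψ, hψ⟩ := h.exists_extend_of_killed hX φ
    refine hx ?_
    have h2 := DFunLike.congr_fun h1 ψ
    rw [LinearMap.lcomp_apply, LinearMap.lcomp_apply'] at h2
    change x • dualTensorEval R N K z φ = x • 0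
    rw [smul_zero, ← map_smul, ← hψ, ← h2]
    rfl
  | succ i ih =>
    obtain ⟨m, K, g, h⟩ := exists_isSES_fin R X
    have hK : ∀ i, ExtVanish R (i + 1) K N := fun i =>
      h.extVanish_left (extVanish_of_projective _ i) (H i)
    exact (h.subsingleton_torGroup_succ_succ_iff i).2
      (ih ((hK 0).killed x) fun i => hK (i + 1))

end HomDuality

section DepthFormulaToAB

open TensorProduct

variable {R : Type} [CommRing R] {M N W X : Type} [AddCommGroup M] [Module R M]
  [AddCommGroup N] [Module R N] [AddCommGroup W] [Module R W]
  [AddCommGroup X] [Module R X]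

/-- An `r`-th syzygy, with the induced shifts of `Ext` in both variables. -/
lemma exists_syzygy [IsNoetherianRing R] (X : Type) [AddCommGroup X] [Module R X]
    [Module.Finite R X] (r : ℕ) :
    ∃ (W : Type) (_ : AddCommGroup W) (_ : Module R W), Module.Finite R W ∧
      (∀ (Y : Type) [AddCommGroup Y] [Module R Y] (i : ℕ),
        ExtVanish R (i + 1) W Y ↔ ExtVanish R (i + r + 1) X Y) ∧
      (∀ (Y : Type) [AddCommGroup Y] [Module R Y] (x : R) (i : ℕ),
        ExtKilled x (i + r + 1) X Y → ExtKilled x (i + 1) W Y) ∧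
      (∀ (Y : Type) [AddCommGroup Y] [Module R Y] (i : ℕ), DualExtVanishAbove R 0 Y →
        (ExtVanish R (i + r + 1) Y W ↔ ExtVanish R (i + 1) Y X)) := by
  induction r with
  | zero =>
    exact ⟨X, _, _, inferInstance, fun _ _ _ _ => Iff.rfl, fun _ _ _ _ _ h => h,
      fun _ _ _ _ _ => Iff.rfl⟩
  | succ r ih =>
    obtain ⟨W, _, _, _, h1, h2, h3⟩ := ih
    obtain ⟨m, K, g, h⟩ := exists_isSES_fin R W
    refine ⟨K, inferInstance, inferInstance, inferInstance, fun Y _ _ i => ?_,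
      fun Y _ _ x i hx => ?_, fun Y _ _ i hY => ?_⟩
    · rw [show i + (r + 1) + 1 = (i + 1) + r + 1 by omega, ← h1 Y (i + 1)]
      exact ⟨fun hK => h.extVanish_right hK (extVanish_of_projective _ (i + 1)),
        fun hW => h.extVanish_left (extVanish_of_projective _ i) hW⟩
    · rw [show i + (r + 1) + 1 = (i + 1) + r + 1 by omega] at hx
      exact h.extKilled_left (extVanish_of_projective _ i) (h2 Y x (i + 1) hx)
    · rw [← h3 Y i hY]
      have hF : ∀ j, ExtVanish R (j + 1) Y (Fin m → R) := fun j =>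
        extVanish_pi' (hY (j + 1) j.succ_pos) m
      exact ⟨fun hK => h.extVanish_right' (hF _) hK, fun hW => h.extVanish_left' hW (hF _)⟩

lemma isSMulRegular_of_injective_dual {x : R} (hx : IsSMulRegular R x)
    {f : X →ₗ[R] Module.Dual R M} (hf : Function.Injective f) : IsSMulRegular X x := by
  intro a b hab
  refine hf (LinearMap.ext fun m => hx ?_)
  have h1 := DFunLike.congr_fun (congrArg f hab) m
  simpa using h1

variable [IsLocalRing R] [IsNoetherianRing R] {s : ℕ}

lemma HasDualExtTop.rdepth_eq (hs : HasDualExtTop R s (R ⧸ maximalIdeal R))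
    [Module.Finite R X] [Nontrivial X] (hX : DualExtVanishAbove R 0 X) : rdepth R X = s := by
  obtain ⟨n, -, hn, -⟩ := hs.exists_isRegular X
  obtain rfl : n = 0 := by
    by_contra h
    exact hn.2 (hX n (Nat.pos_of_ne_zero h))
  simpa using hs.rdepth_add hn

lemma HasDualExtTop.dualExtVanishAbove_of_rdepth_eq
    (hs : HasDualExtTop R s (R ⧸ maximalIdeal R)) [Module.Finite R X] (hX : rdepth R X = s) :
    DualExtVanishAbove R 0 X := by
  rcases subsingleton_or_nontrivial X with h | h
  · exact fun i _ => extVanish_of_subsingleton i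
  obtain ⟨n, -, hn, -⟩ := hs.exists_isRegular X
  have h1 := hs.rdepth_add hn
  rw [hX] at h1
  obtain rfl : n = 0 := by
    have h2 : s + n = s := by exact_mod_cast h1
    omega
  exact hn.1

lemma PropDep.dualExtVanishAbove_tensor (hdep : PropDep R)
    (hs : HasDualExtTop R s (R ⧸ maximalIdeal R)) [Module.Finite R X] [Module.Finite R W]
    (hX : DualExtVanishAbove R 0 X) (hW : DualExtVanishAbove R 0 W) (h : TorVanish R X W) :
    DualExtVanishAbove R 0 (X ⊗[R] W) := by
  rcases subsingleton_or_nontrivial X with _ | _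
  · exact fun i _ => extVanish_of_subsingleton i
  rcases subsingleton_or_nontrivial W with _ | _
  · exact fun i _ => extVanish_of_subsingleton i
  refine hs.dualExtVanishAbove_of_rdepth_eq ?_
  have h1 := hdep X W inferInstance inferInstance inferInstance inferInstance fun i hi => by
    obtain ⟨j, rfl⟩ : ∃ j, i = j + 1 := ⟨i - 1, by omega⟩
    exact h j
  rw [hs.rdepth_eq hX, hs.rdepth_eq hW,
    hs.rdepth_eq (X := R) (dualExtVanishAbove_of_projective 0)] at h1
  exact (ENat.add_left_injective_of_ne_top (ENat.natCast_ne_top s)) h1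

lemma PropDep.extVanish_one (hdep : PropDep R)
    (hs : HasDualExtTop R s (R ⧸ maximalIdeal R)) [Module.Finite R N] [Module.Finite R W]
    (hN : DualExtVanishAbove R 0 N) (hW : DualExtVanishAbove R 0 W) {x : R}
    (hx : IsSMulRegular R x) (hxW : ExtKilled x 1 W N) (H : ∀ i, ExtVanish R (i + 2) W N) :
    ExtVanish R 1 W N := by
  have hT := hs.torVanish_dual hN hx hxW H
  obtain ⟨m, K, g, h⟩ := exists_isSES_fin R W
  have hE : ExtVanish R 1 (Module.Dual R N ⊗[R] W) R :=
    hdep.dualExtVanishAbove_tensor hs (hs.dualExtVanishAbove_dual hN) hW hT 1 one_pos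
  refine h.extVanish_one (extVanish_of_projective _ 0) fun φ => ?_
  obtain ⟨μ, hμ⟩ := (h.lTensor (h.torVanish_iff.1 hT).1).exists_extend hE
    (TensorProduct.lift (LinearMap.llcomp R K N R |>.flip φ))
  let e := LinearEquiv.ofBijective _ (hs.bijective_dual_eval hN)
  refine ⟨e.symm.toLinearMap ∘ₗ (TensorProduct.curry μ).flip, LinearMap.ext fun k => ?_⟩
  simp only [LinearMap.comp_apply, LinearEquiv.coe_coe]
  rw [LinearEquiv.symm_apply_eq]
  ext f
  exact DFunLike.congr_fun hμ (f ⊗ₜ k)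

lemma PropDep.extVanish_descend (hdep : PropDep R)
    (hs : HasDualExtTop R s (R ⧸ maximalIdeal R)) [Module.Finite R N] [Module.Finite R M]
    (hM : DualExtVanishAbove R 0 M) (hN : DualExtVanishAbove R 0 N) {x : R}
    (hxm : x ∈ maximalIdeal R) (hx : IsSMulRegular R x) {r : ℕ}
    (H : ∀ i > r + 1, ExtVanish R i M N) : ExtVanish R (r + 1) M N := by
  have hxM := isSMulRegular_of_injective_dual hx (hs.bijective_dual_eval hM).1
  have hses := hxM.isSES
  obtain ⟨W, _, _, _, h1, h2, -⟩ := exists_syzygy (R := R) (QuotSMulTop x M) (r + 1)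
  refine hses.extVanish_of_lsmul hxm ?_
  have hv : ∀ {Y : Type} [AddCommGroup Y] [Module R Y] (r : ℕ), (∀ i > r, ExtVanish R i M Y) →
      ∀ i > r + 1, ExtVanish R i (QuotSMulTop x M) Y := fun r H i hi => by
    obtain ⟨j, rfl⟩ : ∃ j, i = j + 1 := ⟨i - 1, by omega⟩
    exact hses.extVanish_right (H j (by omega)) (H (j + 1) (by omega))
  have key := hdep.extVanish_one hs (N := N) (W := W) hN (fun i hi => ?_) hx
    (h2 N x 0 (extKilled_of_annihilates _ fun q => ?_)) fun i => ?_
  · rw [h1 N 0, zero_add] at key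
    exact key
  · obtain ⟨j, rfl⟩ : ∃ j, i = j + 1 := ⟨i - 1, by omega⟩
    exact (h1 R j).2 (hv 0 hM _ (by omega))
  · obtain ⟨q, rfl⟩ := hses.surj q
    rw [← map_smul]
    exact hses.exact.apply_apply_eq_zero q
  · exact (h1 N (i + 1)).2 (hv (r + 1) H _ (by omega))

lemma PropDep.extVanish_all (hdep : PropDep R)
    (hs : HasDualExtTop R s (R ⧸ maximalIdeal R)) [Module.Finite R N] [Module.Finite R M]
    (hM : DualExtVanishAbove R 0 M) (hN : DualExtVanishAbove R 0 N) {x : R}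
    (hxm : x ∈ maximalIdeal R) (hx : IsSMulRegular R x) {r : ℕ}
    (H : ∀ i > r, ExtVanish R i M N) : ∀ i > 0, ExtVanish R i M N := by
  induction r with
  | zero => exact H
  | succ r ih =>
    refine ih fun i hi => ?_
    rcases eq_or_lt_of_le (Nat.succ_le_of_lt hi) with rfl | hi
    · exact hdep.extVanish_descend hs hM hN hxm hx H
    · exact H i hi

lemma PropDep.extVanish_of_eventually (hdep : PropDep R) (hdim : 0 < ringKrullDim R)
    (hs : HasDualExtTop R s (R ⧸ maximalIdeal R)) [Module.Finite R N] [Module.Finite R M]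
    {t : ℕ} (H : ∀ i > t, ExtVanish R i M N) : ∀ i > s, ExtVanish R i M N := by
  obtain ⟨x, hxm, hx⟩ := hs.exists_isSMulRegular hdim
  obtain ⟨M', _, _, _, hM, -, -⟩ := exists_syzygy (R := R) M s
  obtain ⟨N', _, _, _, hN, -, hN'⟩ := exists_syzygy (R := R) N s
  have hM' : DualExtVanishAbove R 0 M' := fun i hi => by
    obtain ⟨j, rfl⟩ : ∃ j, i = j + 1 := ⟨i - 1, by omega⟩
    exact (hM R j).2 (hs.dualExtVanishAbove _ (by omega))
  have hv := hdep.extVanish_all hs (M := M') (N := N') hM' (fun i hi => by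
    obtain ⟨j, rfl⟩ : ∃ j, i = j + 1 := ⟨i - 1, by omega⟩
    exact (hN R j).2 (hs.dualExtVanishAbove _ (by omega))) hxm hx (r := t + s) fun i hi => by
      obtain ⟨j, rfl⟩ : ∃ j, i = j + s + 1 := ⟨i - s - 1, by omega⟩
      exact (hN' M' j hM').2 ((hM N j).2 (H _ (by omega)))
  intro i hi
  obtain ⟨j, rfl⟩ : ∃ j, i = j + s + 1 := ⟨i - s - 1, by omega⟩
  exact (hM N j).1 ((hN' M' j hM').1 (hv _ (by omega)))

theorem PropDep.isABRing (hdep : PropDep R) (hGor : IsGorensteinLocalRing R)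
    (hdim : 0 < ringKrullDim R) : IsABRing R := by
  obtain ⟨s, hs⟩ := exists_hasDualExtTop_residue hGor
  refine ⟨hGor, s, fun M N _ _ ⟨t, ht⟩ i hi => ?_⟩
  obtain ⟨j, rfl⟩ : ∃ j, i = j + 1 := ⟨i - 1, by omega⟩
  refine (subsingleton_extGroup_iff_extVanish j M N).2
    (hdep.extVanish_of_eventually hdim hs (t := t) (fun i hi => ?_) (j + 1) hi)
  obtain ⟨k, rfl⟩ : ∃ k, i = k + 1 := ⟨i - 1, by omega⟩
  exact (subsingleton_extGroup_iff_extVanish k M N).1 (ht (k + 1) hi)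

end DepthFormulaToAB

section CosyzygyAndTensor

open TensorProduct

variable {R : Type} [CommRing R] {A B C M N P Λ L X Y : Type} [AddCommGroup A] [Module R A]
  [AddCommGroup B] [Module R B] [AddCommGroup C] [Module R C] [AddCommGroup M] [Module R M]
  [AddCommGroup N] [Module R N] [AddCommGroup P] [Module R P] [AddCommGroup Λ] [Module R Λ]
  [AddCommGroup L] [Module R L] [AddCommGroup X] [Module R X] [AddCommGroup Y] [Module R Y]

lemma nontrivial_tensorProduct [IsLocalRing R] [Module.Finite R M] [Module.Finite R N]
    [Nontrivial M] [Nontrivial N] : Nontrivial (M ⊗[R] N) := by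
  have h : ∀ (M : Type) [AddCommGroup M] [Module R M] [Module.Finite R M] [Nontrivial M],
      Nontrivial (ResidueField R ⊗[R] M) := fun M _ _ _ _ => by
    rw [← not_subsingleton_iff_nontrivial, IsLocalRing.subsingleton_tensorProduct,
      not_subsingleton_iff_nontrivial]
    infer_instance
  have h1 := h M
  have h2 := h N
  rw [← not_subsingleton_iff_nontrivial, ← IsLocalRing.subsingleton_tensorProduct (R := R),
    not_subsingleton_iff_nontrivial]
  exact (AlgebraTensorModule.distribBaseChange R (ResidueField R) M N).toEquiv.nontrivial

lemma TorVanish.symm (h : TorVanish R M N) : TorVanish R N M := by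
  intro i
  induction i generalizing M with
  | zero =>
    obtain ⟨K, Q, _, _, _, _, _, f, g, h'⟩ := exists_isSES_projective (R := R) M
    refine h'.subsingleton_torGroup_one_iff.2 ?_
    rw [← LinearMap.comm_comp_rTensor_comp_comm_eq]
    exact (TensorProduct.comm R Q N).injective.comp ((h'.rTensor_injective_of_torVanish h).comp
      (TensorProduct.comm R N K).injective)
  | succ i ih =>
    obtain ⟨K, Q, _, _, _, _, _, f, g, h'⟩ := exists_isSES_projective (R := R) M
    exact (h'.subsingleton_torGroup_succ_succ_iff i).2 (ih (h'.torVanish_left h))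

lemma dualExtVanishAbove_tensor_fin {n : ℕ} (h : DualExtVanishAbove R n N) (m : ℕ) :
    DualExtVanishAbove R n (N ⊗[R] (Fin m → R)) := fun i hi =>
  extVanish_congr (TensorProduct.piScalarRight R R N (Fin m)).symm i (extVanish_pi (h i hi) m)

lemma dualExtVanishAbove_fin_tensor {n : ℕ} (h : DualExtVanishAbove R n N) (m : ℕ) :
    DualExtVanishAbove R n ((Fin m → R) ⊗[R] N) :=
  dualExtVanishAbove_congr (TensorProduct.comm R _ _) (dualExtVanishAbove_tensor_fin h m)

lemma extVanish_one_iff_of_tensor {m : ℕ} {f : A →ₗ[R] (Fin m → R)} {g : (Fin m → R) →ₗ[R] M}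
    (h : IsSES f g) (hN : DualExtVanishAbove R 0 N) (hT : TorVanish R M N) :
    ExtVanish R 1 (M ⊗[R] N) R ↔ ExtVanish R 1 M (Module.Dual R N) := by
  have h' := h.rTensor (h.rTensor_injective_of_torVanish hT)
  constructor
  · intro H
    refine h.extVanish_one (extVanish_of_projective _ 0) fun φ => ?_
    obtain ⟨ψ, hψ⟩ := h'.exists_extend H (TensorProduct.lift φ)
    refine ⟨TensorProduct.curry ψ, ?_⟩
    ext a n
    exact DFunLike.congr_fun hψ (a ⊗ₜ n)
  · intro H
    refine h'.extVanish_one (dualExtVanishAbove_fin_tensor hN m 1 one_pos) fun φ => ?_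
    obtain ⟨ψ, hψ⟩ := h.exists_extend H (TensorProduct.curry φ)
    refine ⟨TensorProduct.lift ψ, ?_⟩
    ext a n
    exact DFunLike.congr_fun (DFunLike.congr_fun hψ a) n

lemma extVanish_tensor_iff [IsNoetherianRing R] [Module.Finite R M]
    (hN : DualExtVanishAbove R 0 N) (hT : TorVanish R M N) (i : ℕ) :
    ExtVanish R (i + 1) (M ⊗[R] N) R ↔ ExtVanish R (i + 1) M (Module.Dual R N) := by
  induction i generalizing M with
  | zero =>
    obtain ⟨m, K, g, h⟩ := exists_isSES_fin R M
    exact extVanish_one_iff_of_tensor h hN hT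
  | succ i ih =>
    obtain ⟨m, K, g, h⟩ := exists_isSES_fin R M
    have h' := h.rTensor (h.rTensor_injective_of_torVanish hT)
    have hF := dualExtVanishAbove_fin_tensor hN m
    have e1 : ExtVanish R (i + 1 + 1) (M ⊗[R] N) R ↔ ExtVanish R (i + 1) (K ⊗[R] N) R :=
      ⟨fun H => h'.extVanish_left (hF _ i.succ_pos) H,
        fun H => h'.extVanish_right H (hF _ (by omega))⟩
    have e2 : ExtVanish R (i + 1 + 1) M (Module.Dual R N) ↔
        ExtVanish R (i + 1) K (Module.Dual R N) :=
      ⟨fun H => h.extVanish_left (extVanish_of_projective _ _) H,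
        fun H => h.extVanish_right H (extVanish_of_projective _ _)⟩
    rw [e1, e2, ih (h.torVanish_left hT)]

lemma dualTensorHom_rTensor_dualMap (f : A →ₗ[R] B) (z : Module.Dual R B ⊗[R] N) :
    dualTensorHom R A N (f.dualMap.rTensor N z) = (dualTensorHom R B N z).comp f := by
  induction z with
  | zero => simp
  | tmul g n => ext a; simp
  | add x y hx hy => simp only [map_add, hx, hy, LinearMap.add_comp]

lemma dualTensorHom_fin_bijective (m : ℕ) :
    Function.Bijective (dualTensorHom R (Fin m → R) N) :=
  (dualTensorHomEquivOfBasis (N := N) (Pi.basisFun R (Fin m))).bijective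

lemma dualTensorHom_surjective_of_isSES {m : ℕ} {f : Λ →ₗ[R] (Fin m → R)}
    {g : (Fin m → R) →ₗ[R] X} (h : IsSES f g) (hX : ExtVanish R 1 X N) :
    Function.Surjective (dualTensorHom R Λ N) := by
  intro φ
  obtain ⟨ψ, rfl⟩ := h.exists_extend hX φ
  obtain ⟨z, rfl⟩ := (dualTensorHom_fin_bijective m).2 ψ
  exact ⟨_, dualTensorHom_rTensor_dualMap f z⟩

lemma dualTensorHom_injective_of_isSES {m : ℕ} {f : Λ →ₗ[R] (Fin m → R)}
    {g : (Fin m → R) →ₗ[R] X} (h : IsSES f g) (hX : ExtVanish R 1 X N)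
    (hXR : ExtVanish R 1 X R)
    (hs : Function.Surjective (dualTensorHom R X N)) :
    Function.Injective (dualTensorHom R Λ N) := by
  rw [injective_iff_map_eq_zero]
  intro z hz
  obtain ⟨u, rfl⟩ := LinearMap.rTensor_surjective N (g := f.dualMap) (h.hom hXR).surj z
  rw [dualTensorHom_rTensor_dualMap] at hz
  obtain ⟨w, hw⟩ := ((h.hom hX).exact _).1 hz
  obtain ⟨v, rfl⟩ := hs w
  have h1 := dualTensorHom_rTensor_dualMap g v
  rw [← (dualTensorHom_fin_bijective m).1 (h1.trans hw), ← LinearMap.rTensor_comp_apply]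
  have h2 : f.dualMap ∘ₗ g.dualMap = 0 := by
    ext φ a
    simp [h.exact.apply_apply_eq_zero]
  rw [h2, LinearMap.rTensor_zero, LinearMap.zero_apply]

variable [IsLocalRing R] [IsNoetherianRing R] {s : ℕ}

/-- Over a Gorenstein ring, a maximal Cohen–Macaulay module embeds in a finite free module with
maximal Cohen–Macaulay cokernel. -/
lemma HasDualExtTop.exists_cosyzygy (hs : HasDualExtTop R s (R ⧸ maximalIdeal R))
    [Module.Finite R Λ] (hΛ : DualExtVanishAbove R 0 Λ) :
    ∃ (m : ℕ) (f : Λ →ₗ[R] (Fin m → R)) (X : Submodule R (Fin m → R)),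
      IsSES f X.mkQ ∧ DualExtVanishAbove R 0 ((Fin m → R) ⧸ X) := by
  classical
  obtain ⟨m, π, hπ⟩ := Module.Finite.exists_fin' R (Module.Dual R Λ)
  let f : Λ →ₗ[R] (Fin m → R) := LinearMap.pi fun j => π (Pi.single j 1)
  have hf : ∀ c : Fin m → R, π c = (Fintype.linearCombination R c) ∘ₗ f := fun c => by
    conv_lhs => rw [pi_eq_sum_univ' c, map_sum]
    ext l
    simp [f, Fintype.linearCombination_apply, mul_comm]
  have h : IsSES f (LinearMap.range f).mkQ := by
    refine ⟨?_, LinearMap.exact_map_mkQ_range f, Submodule.mkQ_surjective _⟩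
    rw [injective_iff_map_eq_zero]
    intro l hl
    refine (injective_iff_map_eq_zero _).1 (hs.bijective_dual_eval hΛ).1 l ?_
    ext φ
    obtain ⟨c, rfl⟩ := hπ φ
    rw [hf]
    simp [hl]
  refine ⟨m, f, _, h, fun i hi => ?_⟩
  obtain ⟨j, rfl⟩ : ∃ j, i = j + 1 := ⟨i - 1, by omega⟩
  cases j with
  | zero =>
    refine h.extVanish_one (extVanish_of_projective _ 0) fun φ => ?_
    obtain ⟨c, rfl⟩ := hπ φ
    exact ⟨_, (hf c).symm⟩
  | succ j => exact h.extVanish_right (hΛ (j + 1) j.succ_pos) (extVanish_of_projective _ _)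

end CosyzygyAndTensor

section ABToDepthFormula

open TensorProduct

variable {R : Type} [CommRing R] {A B M N Λ L : Type} [AddCommGroup A] [Module R A]
  [AddCommGroup B] [Module R B] [AddCommGroup M] [Module R M] [AddCommGroup N] [Module R N]
  [AddCommGroup Λ] [Module R Λ] [AddCommGroup L] [Module R L]

/-- `n` bounds the vanishing of `Ext`: finitely generated modules whose `Ext` eventually
vanishes have vanishing `Ext` in all degrees above `n`. -/
def IsExtBound (R : Type) [CommRing R] (n : ℕ) : Prop :=
  ∀ (M N : Type) [AddCommGroup M] [Module R M] [AddCommGroup N] [Module R N]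
    [Module.Finite R M] [Module.Finite R N],
    (∃ t, ∀ i > t, ExtVanish R i M N) → ∀ i > n, ExtVanish R i M N

lemma IsABRing.exists_isExtBound [IsLocalRing R] (h : IsABRing R) : ∃ n, IsExtBound R n := by
  obtain ⟨-, n, hn⟩ := h
  refine ⟨n, fun M N _ _ _ _ _ _ ⟨t, ht⟩ i hi => ?_⟩
  obtain ⟨j, rfl⟩ : ∃ j, i = j + 1 := ⟨i - 1, by omega⟩
  refine (subsingleton_extGroup_iff_extVanish j (ModuleCat.of R M) (ModuleCat.of R N)).1
    (hn (ModuleCat.of R M) (ModuleCat.of R N) inferInstance inferInstance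
      ⟨t, fun i hi => ?_⟩ _ hi)
  obtain ⟨k, rfl⟩ : ∃ k, i = k + 1 := ⟨i - 1, by omega⟩
  exact (subsingleton_extGroup_iff_extVanish k _ _).2 (ht (k + 1) hi)

lemma curry_dualDistrib (z : Module.Dual R M ⊗[R] Module.Dual R N) :
    TensorProduct.curry (dualDistrib R M N z) = dualTensorHom R M (Module.Dual R N) z := by
  induction z with
  | zero => ext; simp
  | tmul f g => ext; simp
  | add x y hx hy => rw [map_add, map_add, ← hx, ← hy]; rfl

lemma dualDistrib_injective_of_dualTensorHom
    (h : Function.Injective (dualTensorHom R M (Module.Dual R N))) :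
    Function.Injective (dualDistrib R M N) := fun x y hxy => h <| by
  rw [← curry_dualDistrib, ← curry_dualDistrib, hxy]

lemma dualDistrib_fin_left_surjective (m : ℕ) :
    Function.Surjective (dualDistrib R (Fin m → R) N) := fun φ => by
  obtain ⟨z, hz⟩ := (dualTensorHom_fin_bijective m).2 (TensorProduct.curry φ)
  exact ⟨z, TensorProduct.curry_injective ((curry_dualDistrib z).trans hz)⟩

lemma dualDistrib_comm (z : Module.Dual R M ⊗[R] Module.Dual R N) :
    dualDistrib R N M (TensorProduct.comm R _ _ z) =
      dualDistrib R M N z ∘ₗ (TensorProduct.comm R N M).toLinearMap := by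
  induction z with
  | zero => simp
  | tmul f g => ext; simp [mul_comm]
  | add x y hx hy => simp only [map_add, hx, hy, LinearMap.add_comp]

lemma dualDistrib_fin_right_surjective (m : ℕ) :
    Function.Surjective (dualDistrib R N (Fin m → R)) := fun φ => by
  obtain ⟨z, hz⟩ := dualDistrib_fin_left_surjective m
    (φ ∘ₗ (TensorProduct.comm R (Fin m → R) N).toLinearMap)
  refine ⟨TensorProduct.comm R _ _ z, ?_⟩
  rw [dualDistrib_comm, hz]
  ext
  simp

lemma dualDistrib_rTensor_dualMap (f : A →ₗ[R] B) (z : Module.Dual R B ⊗[R] Module.Dual R N) :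
    dualDistrib R A N (f.dualMap.rTensor _ z) = dualDistrib R B N z ∘ₗ f.rTensor N := by
  induction z with
  | zero => simp
  | tmul g n => ext; simp
  | add x y hx hy => simp only [map_add, hx, hy, LinearMap.add_comp]

lemma dualDistrib_lTensor_dualMap (f : A →ₗ[R] B) (z : Module.Dual R N ⊗[R] Module.Dual R B) :
    dualDistrib R N A (f.dualMap.lTensor _ z) = dualDistrib R N B z ∘ₗ f.lTensor N := by
  induction z with
  | zero => simp
  | tmul g n => ext; simp
  | add x y hx hy => simp only [map_add, hx, hy, LinearMap.add_comp]

lemma nontrivial_quotient_range {f : A →ₗ[R] B} (hf : ¬ Function.Surjective f) :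
    Nontrivial (B ⧸ LinearMap.range f) :=
  Submodule.Quotient.nontrivial_iff.2 fun h => hf (LinearMap.range_eq_top.1 h)

/-- If `Λ* ⊗ L* → (Λ ⊗ L)*` is injective, then some functional on `Λ ⊗ L` is not a sum of
functionals extending along `a ⊗ L` and along `Λ ⊗ b`. -/
lemma exists_functional_not_extending [IsLocalRing R] [Module.Finite R (Module.Dual R Λ)]
    [Module.Finite R (Module.Dual R L)] (hinj : Function.Injective (dualDistrib R Λ L))
    {p r : ℕ} {a : Λ →ₗ[R] (Fin p → R)} {b : L →ₗ[R] (Fin r → R)}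
    (ha : ¬ Function.Surjective a.dualMap) (hb : ¬ Function.Surjective b.dualMap) :
    ∃ φ : Λ ⊗[R] L →ₗ[R] R, ∀ (ψ₁ : (Fin p → R) ⊗[R] L →ₗ[R] R)
      (ψ₂ : Λ ⊗[R] (Fin r → R) →ₗ[R] R), φ ≠ ψ₁ ∘ₗ a.rTensor L + ψ₂ ∘ₗ b.lTensor Λ := by
  have := nontrivial_quotient_range ha
  have := nontrivial_quotient_range hb
  let q := TensorProduct.map (LinearMap.range a.dualMap).mkQ (LinearMap.range b.dualMap).mkQ
  have hq : Function.Surjective q :=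
    TensorProduct.map_surjective (Submodule.mkQ_surjective _) (Submodule.mkQ_surjective _)
  have : Nontrivial ((Module.Dual R Λ ⧸ LinearMap.range a.dualMap) ⊗[R]
      (Module.Dual R L ⧸ LinearMap.range b.dualMap)) := nontrivial_tensorProduct
  obtain ⟨y, hy⟩ := exists_ne (0 : (Module.Dual R Λ ⧸ LinearMap.range a.dualMap) ⊗[R]
      (Module.Dual R L ⧸ LinearMap.range b.dualMap))
  obtain ⟨z, rfl⟩ := hq y
  refine ⟨dualDistrib R Λ L z, fun ψ₁ ψ₂ h => hy ?_⟩
  obtain ⟨v₁, rfl⟩ := dualDistrib_fin_left_surjective p ψ₁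
  obtain ⟨v₂, rfl⟩ := dualDistrib_fin_right_surjective r ψ₂
  rw [← dualDistrib_rTensor_dualMap, ← dualDistrib_lTensor_dualMap, ← map_add] at h
  rw [hinj h, map_add]
  have h1 : q ∘ₗ a.dualMap.rTensor _ = 0 := by
    rw [LinearMap.map_comp_rTensor, LinearMap.range_mkQ_comp, TensorProduct.map_zero_left]
  have h2 : q ∘ₗ b.dualMap.lTensor _ = 0 := by
    rw [LinearMap.map_comp_lTensor, LinearMap.range_mkQ_comp, TensorProduct.map_zero_right]
  rw [← LinearMap.comp_apply, ← LinearMap.comp_apply, h1, h2]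
  simp

/-- Top degrees `a` and `b` of `Ext(-, R)` add up under Tor-independent tensor products. -/
def DualExtTopAdds (R : Type) [CommRing R] (a b : ℕ) : Prop :=
  ∀ (M N : Type) [AddCommGroup M] [Module R M] [AddCommGroup N] [Module R N]
    [Module.Finite R M] [Module.Finite R N], HasDualExtTop R a M → HasDualExtTop R b N →
    TorVanish R M N → ¬ ExtVanish R (a + b) (M ⊗[R] N) R

lemma DualExtTopAdds.symm {a b : ℕ} (h : DualExtTopAdds R a b) : DualExtTopAdds R b a :=
  fun M N _ _ _ _ _ _ hM hN hT H => h N M hN hM hT.symm <| by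
    rw [add_comm]
    exact extVanish_congr (TensorProduct.comm R M N) _ H

lemma not_surjective_dualMap {m : ℕ} {f : L →ₗ[R] (Fin m → R)} {g : (Fin m → R) →ₗ[R] N}
    (h : IsSES f g) (hN : ¬ ExtVanish R 1 N R) : ¬ Function.Surjective f.dualMap :=
  fun H => hN (h.extVanish_one (extVanish_of_projective _ 0) H)

lemma DualExtTopAdds.of_one_left [IsNoetherianRing R] {b : ℕ} (h : DualExtTopAdds R 1 b) (a : ℕ) :
    DualExtTopAdds R (a + 1) b := by
  induction a with
  | zero => exact h
  | succ a ih =>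
    intro M N _ _ _ _ _ _ hM hN hT H
    obtain ⟨m, K, g, h⟩ := exists_isSES_fin R M
    refine ih K N ⟨h.dualExtVanishAbove_left (dualExtVanishAbove_of_projective 0) hM.1,
      fun hK => hM.2 (h.extVanish_right hK (extVanish_of_projective _ _))⟩ hN
      (h.torVanish_left hT) ((h.rTensor (h.rTensor_injective_of_torVanish hT)).extVanish_left
        (dualExtVanishAbove_fin_tensor hN.1 m _ (by omega)) ?_)
    rwa [show a + 1 + b + 1 = a + 1 + 1 + b by omega]

variable [IsLocalRing R] [IsNoetherianRing R] {s n : ℕ}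

lemma HasDualExtTop.exists_iterated_cosyzygy (hs : HasDualExtTop R s (R ⧸ maximalIdeal R))
    (Λ : Type) [AddCommGroup Λ] [Module R Λ] [Module.Finite R Λ]
    (hΛ : DualExtVanishAbove R 0 Λ) (r : ℕ) :
    ∃ (W : Type) (_ : AddCommGroup W) (_ : Module R W), Module.Finite R W ∧
      DualExtVanishAbove R 0 W ∧ ∀ (Y : Type) [AddCommGroup Y] [Module R Y] (i : ℕ),
        ExtVanish R (i + r + 1) W Y ↔ ExtVanish R (i + 1) Λ Y := by
  induction r with
  | zero => exact ⟨Λ, _, _, inferInstance, hΛ, fun _ _ _ _ => Iff.rfl⟩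
  | succ r ih =>
    obtain ⟨W, _, _, _, hW, h1⟩ := ih
    obtain ⟨m, f, X, h, hX⟩ := hs.exists_cosyzygy hW
    refine ⟨(Fin m → R) ⧸ X, inferInstance, inferInstance, inferInstance, hX,
      fun Y _ _ i => ?_⟩
    rw [← h1 Y i]
    exact ⟨fun H => h.extVanish_left (extVanish_of_projective _ _) H,
      fun H => h.extVanish_right H (extVanish_of_projective _ _)⟩

lemma IsExtBound.extVanish_of_eventually (hn : IsExtBound R n)
    (hs : HasDualExtTop R s (R ⧸ maximalIdeal R)) [Module.Finite R Λ] [Module.Finite R N]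
    (hΛ : DualExtVanishAbove R 0 Λ) {t : ℕ} (H : ∀ i > t, ExtVanish R i Λ N) (i : ℕ) :
    ExtVanish R (i + 1) Λ N := by
  obtain ⟨W, _, _, _, -, hW⟩ := hs.exists_iterated_cosyzygy Λ hΛ n
  refine (hW N i).1 (hn W N ⟨t + n, fun j hj => ?_⟩ _ (by omega))
  obtain ⟨k, rfl⟩ : ∃ k, j = k + n + 1 := ⟨j - n - 1, by omega⟩
  exact (hW N k).2 (H _ (by omega))

lemma IsExtBound.extVanish_cosyzygy (hn : IsExtBound R n)
    (hs : HasDualExtTop R s (R ⧸ maximalIdeal R)) [Module.Finite R M] [Module.Finite R N]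
    (hM : DualExtVanishAbove R 0 M) {m : ℕ} {f : Λ →ₗ[R] (Fin m → R)}
    {g : (Fin m → R) →ₗ[R] M} (h : IsSES f g) (H : ∀ i, ExtVanish R (i + 1) Λ N) (i : ℕ) :
    ExtVanish R (i + 1) M N := by
  refine hn.extVanish_of_eventually hs hM (t := 1) (fun i hi => ?_) i
  obtain ⟨j, rfl⟩ : ∃ j, i = j + 1 + 1 := ⟨i - 2, by omega⟩
  exact h.extVanish_right (H j) (extVanish_of_projective _ _)

lemma IsExtBound.dualTensorHom_injective (hn : IsExtBound R n)
    (hs : HasDualExtTop R s (R ⧸ maximalIdeal R)) [Module.Finite R Λ] [Module.Finite R N]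
    (hΛ : DualExtVanishAbove R 0 Λ) (H : ∀ i, ExtVanish R (i + 1) Λ N) :
    Function.Injective (dualTensorHom R Λ N) := by
  obtain ⟨m, f, X, h, hX⟩ := hs.exists_cosyzygy hΛ
  obtain ⟨m', f', X', h', hX'⟩ := hs.exists_cosyzygy hX
  have H1 := hn.extVanish_cosyzygy hs hX h H
  exact dualTensorHom_injective_of_isSES h (H1 0) (hX 1 one_pos)
    (dualTensorHom_surjective_of_isSES h' (hn.extVanish_cosyzygy hs hX' h' H1 0))

lemma IsExtBound.extVanish_dual (hn : IsExtBound R n)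
    (hs : HasDualExtTop R s (R ⧸ maximalIdeal R)) [Module.Finite R M] [Module.Finite R N]
    (hM : DualExtVanishAbove R 0 M) (hN : DualExtVanishAbove R 0 N) (hT : TorVanish R M N)
    (i : ℕ) : ExtVanish R (i + 1) M (Module.Dual R N) := by
  refine hn.extVanish_of_eventually hs hM (t := s) (fun i hi => ?_) i
  obtain ⟨j, rfl⟩ : ∃ j, i = j + 1 := ⟨i - 1, by omega⟩
  exact (extVanish_tensor_iff hN hT j).1 (hs.dualExtVanishAbove _ hi)

lemma IsExtBound.dualDistrib_injective (hn : IsExtBound R n)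
    (hs : HasDualExtTop R s (R ⧸ maximalIdeal R)) [Module.Finite R M] [Module.Finite R N]
    (hM : DualExtVanishAbove R 0 M) (hN : DualExtVanishAbove R 0 N) (hT : TorVanish R M N) :
    Function.Injective (dualDistrib R M N) :=
  dualDistrib_injective_of_dualTensorHom
    (hn.dualTensorHom_injective hs hM (hn.extVanish_dual hs hM hN hT))

lemma IsExtBound.dualExtVanishAbove_tensor (hn : IsExtBound R n)
    (hs : HasDualExtTop R s (R ⧸ maximalIdeal R)) {a b : ℕ} [Module.Finite R M]
    [Module.Finite R N] (hM : DualExtVanishAbove R a M) (hN : DualExtVanishAbove R b N)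
    (hT : TorVanish R M N) : DualExtVanishAbove R (a + b) (M ⊗[R] N) := by
  induction a generalizing M with
  | zero =>
    induction b generalizing N with
    | zero =>
      intro i hi
      obtain ⟨j, rfl⟩ : ∃ j, i = j + 1 := ⟨i - 1, by omega⟩
      exact (extVanish_tensor_iff hN hT j).2 (hn.extVanish_dual hs hM hN hT j)
    | succ b ih =>
      obtain ⟨m, K, g, h⟩ := exists_isSES_fin R N
      obtain ⟨h1, h2⟩ := h.torVanish_iff.1 hT
      exact (h.lTensor h1).dualExtVanishAbove_right (dualExtVanishAbove_tensor_fin hM m)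
        (ih (h.dualExtVanishAbove_left (dualExtVanishAbove_of_projective 0) hN) h2)
  | succ a ih =>
    obtain ⟨m, K, g, h⟩ := exists_isSES_fin R M
    have h1 := h.rTensor (h.rTensor_injective_of_torVanish hT)
    have h2 := ih (h.dualExtVanishAbove_left (dualExtVanishAbove_of_projective 0) hM)
      (h.torVanish_left hT)
    intro i hi
    obtain ⟨j, rfl⟩ : ∃ j, i = j + 1 := ⟨i - 1, by omega⟩
    exact h1.extVanish_right (h2 j (by omega)) (dualExtVanishAbove_fin_tensor hN m _ (by omega))

lemma IsExtBound.dualExtTopAdds_zero_zero (hn : IsExtBound R n)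
    (hs : HasDualExtTop R s (R ⧸ maximalIdeal R)) : DualExtTopAdds R 0 0 := by
  intro M N _ _ _ _ _ _ hM hN hT
  have hne : ∀ (M : Type) [AddCommGroup M] [Module R M], HasDualExtTop R 0 M → Nontrivial M :=
    fun M _ _ h => not_subsingleton_iff_nontrivial.1 fun _ => h.2 (extVanish_of_subsingleton 0)
  have := hne M hM
  have := hne N hN
  have : Nontrivial (M ⊗[R] N) := nontrivial_tensorProduct
  obtain ⟨k, -, hk, -⟩ := hs.exists_isRegular (M ⊗[R] N)
  obtain rfl : k = 0 := by
    by_contra h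
    exact hk.2 (hn.dualExtVanishAbove_tensor hs hM.1 hN.1 hT k (Nat.pos_of_ne_zero h))
  exact hk.2

lemma IsExtBound.dualExtTopAdds_zero_one (hn : IsExtBound R n)
    (hs : HasDualExtTop R s (R ⧸ maximalIdeal R)) : DualExtTopAdds R 0 1 := by
  intro M N _ _ _ _ _ _ hM hN hT H
  obtain ⟨m, K, g, h⟩ := exists_isSES_fin R N
  obtain ⟨h1, h2⟩ := h.torVanish_iff.1 hT
  have hK := h.dualExtVanishAbove_left (dualExtVanishAbove_of_projective 0) hN.1
  obtain ⟨φ, hφ⟩ := exists_functional_not_extending (hn.dualDistrib_injective hs hM.1 hK h2)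
    (a := (0 : M →ₗ[R] (Fin 0 → R))) (fun hsurj => hM.2 (extVanish_zero_iff.2 hsurj.subsingleton))
    (not_surjective_dualMap h hN.2)
  obtain ⟨ψ, hψ⟩ := (h.lTensor h1).exists_extend H φ
  exact hφ 0 ψ (by rw [LinearMap.zero_comp, zero_add, hψ])

lemma IsExtBound.dualExtTopAdds_one_one (hn : IsExtBound R n)
    (hs : HasDualExtTop R s (R ⧸ maximalIdeal R)) : DualExtTopAdds R 1 1 := by
  intro M N _ _ _ _ _ _ hM hN hT H
  obtain ⟨p, Λ, g', h'⟩ := exists_isSES_fin R M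
  obtain ⟨m, L, g, h⟩ := exists_isSES_fin R N
  obtain ⟨h1, h2⟩ := h.torVanish_iff.1 hT
  have hL := h.dualExtVanishAbove_left (dualExtVanishAbove_of_projective 0) hN.1
  have hΛ := h'.dualExtVanishAbove_left (dualExtVanishAbove_of_projective 0) hM.1
  obtain ⟨φ, hφ⟩ := exists_functional_not_extending
    (hn.dualDistrib_injective hs hΛ hL (h'.torVanish_left h2))
    (not_surjective_dualMap h' hM.2) (not_surjective_dualMap h hN.2)
  obtain ⟨ψ₁, ψ₂, hψ⟩ := extend_of_extVanish_two
    (h'.rTensor (h'.rTensor_injective_of_torVanish h2))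
    (h'.rTensor (h'.rTensor_injective_of_torVanish (torVanish_of_projective (P := Fin m → R))))
    (h.lTensor h1) (a := L.subtype.lTensor Λ) (b := L.subtype.lTensor (Fin p → R))
    (LinearMap.ext fun z => (rTensor_lTensor_comm _ _ z).symm)
    (LinearMap.ext fun z => (rTensor_lTensor_comm _ _ z).symm) H
    (dualExtVanishAbove_tensor_fin (dualExtVanishAbove_of_projective 0) m 1 one_pos) φ
  exact hφ ψ₂ ψ₁ (by rw [hψ, add_comm])

lemma IsExtBound.dualExtTopAdds (hn : IsExtBound R n)
    (hs : HasDualExtTop R s (R ⧸ maximalIdeal R)) (a b : ℕ) : DualExtTopAdds R a b := by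
  rcases a with _ | a <;> rcases b with _ | b
  · exact hn.dualExtTopAdds_zero_zero hs
  · exact ((hn.dualExtTopAdds_zero_one hs).symm.of_one_left b).symm
  · exact (hn.dualExtTopAdds_zero_one hs).symm.of_one_left a
  · exact ((hn.dualExtTopAdds_one_one hs).of_one_left b).symm.of_one_left a

theorem IsABRing.propDep (h : IsABRing R) : PropDep R := by
  obtain ⟨s, hs⟩ := exists_hasDualExtTop_residue h.1
  obtain ⟨n, hn⟩ := h.exists_isExtBound
  intro M N _ _ _ _ _ _ _ _ hTor
  have hT : TorVanish R M N := fun i => hTor (i + 1) i.succ_pos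
  obtain ⟨a, -, ha, -⟩ := hs.exists_isRegular M
  obtain ⟨b, -, hb, -⟩ := hs.exists_isRegular N
  have h1 := hs.rdepth_add ha
  have h2 := hs.rdepth_add hb
  have h3 := hs.rdepth_add (M := M ⊗[R] N)
    ⟨hn.dualExtVanishAbove_tensor hs ha.1 hb.1 hT, hn.dualExtTopAdds hs a b M N ha hb hT⟩
  rw [hs.rdepth_eq (X := R) (dualExtVanishAbove_of_projective 0)]
  have hfin : ∀ {x : ℕ∞} {k : ℕ}, x + k = s → ∃ y : ℕ, x = y := fun {x k} hx => by
    induction x using ENat.recTopCoe with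
    | top => exact absurd hx.symm (by simp)
    | coe y => exact ⟨y, rfl⟩
  obtain ⟨x, hx⟩ := hfin h1
  obtain ⟨y, hy⟩ := hfin h2
  obtain ⟨z, hz⟩ := hfin h3
  rw [hx] at h1 ⊢
  rw [hy] at h2 ⊢
  rw [hz] at h3 ⊢
  norm_cast at h1 h2 h3 ⊢
  omega

end ABToDepthFormula

/-- a Gorenstein local ring of positive dimension satisfies the
depth formula iff it is an AB ring. -/
theorem stmt16 (R : Type) [CommRing R] [IsLocalRing R] [IsNoetherianRing R]
    (hGor : IsGorensteinLocalRing R) (hdim : 0 < ringKrullDim R) :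
    PropDep R ↔ IsABRing R := ⟨fun h => h.isABRing hGor hdim, fun h => h.propDep⟩
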